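/- Monotone convergence of the penalty approximation: assume (H.1) and (H.2). For each ρ ≥ 0 let u^ρ be the unique bounded viscosity solution of the penalized system with parameter ρ. Then the HJBQVI system has a unique bounded viscosity solution u; the family (u^ρ) is monotone decreasing in ρ (if ρ₁ ≤ ρ₂ then u^{ρ₁} ≥ u^{ρ₂} ≥ u componentwise); and u^ρ converges to u uniformly on compact subsets of ℝ^d as ρ → ∞. -/

import Mathlib

noncomputable section
open scoped BigOperators RealInnerProductSpace
open Filter Topology Matrix

namespace HJBQVI

abbrev E (d : ℕ) : Type := EuclideanSpace ℝ (Fin d)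

variable {d d' M : ℕ}

/-- Frobenius norm of a matrix. -/
def frobNorm (A : Matrix (Fin d) (Fin d') ℝ) : ℝ :=
  Real.sqrt (∑ k, ∑ l, (A k l) ^ 2)

/-- Hessian matrix of a real-valued function, via the second iterated Fréchet derivative. -/
def hess (φ : E d → ℝ) (x : E d) : Matrix (Fin d) (Fin d) ℝ :=
  Matrix.of fun i j =>
    iteratedFDeriv ℝ 2 φ x ![EuclideanSpace.single i (1 : ℝ), EuclideanSpace.single j (1 : ℝ)]

/-- Semiconcavity with constant `C`. -/
def Semiconcave (φ : E d → ℝ) (C : ℝ) : Prop :=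
  ∀ x h : E d, φ (x + h) - 2 * φ x + φ (x - h) ≤ C * ‖h‖ ^ 2

/-- Membership in `C⁰₁(ℝ^d)`: bounded, continuous, Lipschitz. -/
def InC01 (f : E d → ℝ) : Prop :=
  Continuous f ∧ (∃ C, ∀ x, |f x| ≤ C) ∧ ∃ L, ∀ x y, |f x - f y| ≤ L * ‖x - y‖

/-- Uniform boundedness of a system of functions. -/
def Bdd (u : Fin M → E d → ℝ) : Prop := ∃ C, ∀ i x, |u i x| ≤ C

/-- Coefficient data for the weakly coupled HJB operator. -/
structure HJBData (d d' M : ℕ) (𝒜 : Type) [MetricSpace 𝒜] where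
  A : Fin M → Set 𝒜
  σm : Fin M → 𝒜 → E d → Matrix (Fin d) (Fin d') ℝ
  bv : Fin M → 𝒜 → E d → E d
  cz : Fin M → 𝒜 → E d → ℝ
  runCost : Fin M → 𝒜 → E d → ℝ
  dcp : Fin M → Fin M → 𝒜 → E d → ℝ

variable {𝒜 𝒵 : Type} [MetricSpace 𝒜] [MetricSpace 𝒵]

/-- The linear operator `L^α_i(x, s, p, X)`. -/
def HJBData.L (P : HJBData d d' M 𝒜) (i : Fin M) (α : 𝒜) (x : E d)
    (s : Fin M → ℝ) (p : E d) (X : Matrix (Fin d) (Fin d) ℝ) : ℝ :=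
  - Matrix.trace (((1 : ℝ) / 2) • (P.σm i α x * (P.σm i α x)ᵀ) * X)
  - ⟪P.bv i α x, p⟫ + P.cz i α x * s i - P.runCost i α x
  - ∑ j ∈ Finset.univ.erase i, P.dcp i j α x * s j

/-- The Hamiltonian `sup_{α ∈ A_i} L^α_i`. -/
def HJBData.Ham (P : HJBData d d' M 𝒜) (i : Fin M) (x : E d)
    (s : Fin M → ℝ) (p : E d) (X : Matrix (Fin d) (Fin d) ℝ) : ℝ :=
  sSup ((fun α => P.L i α x s p X) '' P.A i)

/-- Data of the impulse intervention operator. -/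
structure ImpulseData (d M : ℕ) (𝒵 : Type) [MetricSpace 𝒵] where
  Z : Fin M → E d → Set 𝒵
  Γ : Fin M → E d → 𝒵 → E d
  K : Fin M → E d → 𝒵 → ℝ

/-- The intervention operator `(M_i u)(x) = min_{z ∈ Z_i(x)} [u_i(Γ_i(x,z)) + K_i(x,z)]`. -/
def ImpulseData.Mop (Q : ImpulseData d M 𝒵) (i : Fin M) (u : Fin M → E d → ℝ) (x : E d) : ℝ :=
  sInf ((fun z => u i (Q.Γ i x z) + Q.K i x z) '' Q.Z i x)

/-- Type of (possibly nonlocal) degenerate elliptic operators. -/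
abbrev Op (d M : ℕ) : Type :=
  Fin M → E d → (Fin M → E d → ℝ) → E d → Matrix (Fin d) (Fin d) ℝ → ℝ

/-- Viscosity subsolution (upper semicontinuous, tested from above by C² functions). -/
def IsSubsolution (F : Op d M) (u : Fin M → E d → ℝ) : Prop :=
  (∀ i, UpperSemicontinuous (u i)) ∧
  ∀ (i : Fin M) (φ : E d → ℝ), ContDiff ℝ 2 φ → ∀ x : E d,
    IsLocalMax (fun y => u i y - φ y) x → F i x u (gradient φ x) (hess φ x) ≤ 0

/-- Viscosity supersolution. -/
def IsSupersolution (F : Op d M) (u : Fin M → E d → ℝ) : Prop :=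
  (∀ i, LowerSemicontinuous (u i)) ∧
  ∀ (i : Fin M) (φ : E d → ℝ), ContDiff ℝ 2 φ → ∀ x : E d,
    IsLocalMin (fun y => u i y - φ y) x → 0 ≤ F i x u (gradient φ x) (hess φ x)

/-- Viscosity solution: continuous and both a sub- and a supersolution. -/
def IsSolution (F : Op d M) (u : Fin M → E d → ℝ) : Prop :=
  (∀ i, Continuous (u i)) ∧ IsSubsolution F u ∧ IsSupersolution F u

/-- Pure HJB operator. -/
def Fhjb (P : HJBData d d' M 𝒜) : Op d M :=
  fun i x u p X => P.Ham i x (fun j => u j x) p X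

/-- Obstacle problem operator with obstacle `Ψ`. -/
def Fob (P : HJBData d d' M 𝒜) (Ψ : Fin M → E d → ℝ) : Op d M :=
  fun i x u p X => max (P.Ham i x (fun j => u j x) p X) (u i x - Ψ i x)

/-- Penalized obstacle problem operator. -/
def FobPen (P : HJBData d d' M 𝒜) (Ψ : Fin M → E d → ℝ) (ρ : ℝ) : Op d M :=
  fun i x u p X => P.Ham i x (fun j => u j x) p X + ρ * max (u i x - Ψ i x) 0

/-- The HJBQVI operator. -/
def Fqvi (P : HJBData d d' M 𝒜) (Q : ImpulseData d M 𝒵) : Op d M :=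
  fun i x u p X => max (P.Ham i x (fun j => u j x) p X) (u i x - Q.Mop i u x)

/-- The penalized HJBQVI operator with penalty parameter `ρ`. -/
def Fpen (P : HJBData d d' M 𝒜) (Q : ImpulseData d M 𝒵) (ρ : ℝ) : Op d M :=
  fun i x u p X => P.Ham i x (fun j => u j x) p X + ρ * max (u i x - Q.Mop i u x) 0

/-- Assumption (H.1). -/
def H1 (P : HJBData d d' M 𝒜) (C lam0 : ℝ) : Prop :=
  0 < lam0 ∧
  (∀ i, (P.A i).Nonempty ∧ IsCompact (P.A i)) ∧
  ∀ i, ∀ α ∈ P.A i,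
    (∀ k l, Continuous fun x => P.σm i α x k l) ∧
    Continuous (P.bv i α) ∧ Continuous (P.cz i α) ∧ Continuous (P.runCost i α) ∧
    (∀ j, Continuous (P.dcp i j α)) ∧
    (∀ x, frobNorm (P.σm i α x) ≤ C) ∧
    (∀ x y, frobNorm (P.σm i α x - P.σm i α y) ≤ C * ‖x - y‖) ∧
    (∀ x, ‖P.bv i α x‖ ≤ C) ∧ (∀ x y, ‖P.bv i α x - P.bv i α y‖ ≤ C * ‖x - y‖) ∧
    (∀ x, |P.cz i α x| ≤ C) ∧ (∀ x y, |P.cz i α x - P.cz i α y| ≤ C * ‖x - y‖) ∧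
    (∀ x, |P.runCost i α x| ≤ C) ∧
    (∀ x y, |P.runCost i α x - P.runCost i α y| ≤ C * ‖x - y‖) ∧
    (∀ j, (∀ x, |P.dcp i j α x| ≤ C) ∧ ∀ x y, |P.dcp i j α x - P.dcp i j α y| ≤ C * ‖x - y‖) ∧
    (∀ j ∈ Finset.univ.erase i, ∀ x, 0 ≤ P.dcp i j α x) ∧
    ∀ x, lam0 ≤ P.cz i α x - ∑ j ∈ Finset.univ.erase i, P.dcp i j α x

/-- Assumption (H.2). -/
def H2 (Q : ImpulseData d M 𝒵) (κ₀ : ℝ) : Prop :=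
  0 < κ₀ ∧
  (∀ i x, (Q.Z i x).Nonempty ∧ IsCompact (Q.Z i x)) ∧
  (∀ i, Continuous fun p : E d × 𝒵 => Q.Γ i p.1 p.2) ∧
  (∀ i, Continuous fun p : E d × 𝒵 => Q.K i p.1 p.2) ∧
  (∀ (i : Fin M) (x : E d), ∀ ε > (0 : ℝ), ∃ δ > (0 : ℝ), ∀ y, dist y x < δ →
      Metric.hausdorffDist (Q.Z i x) (Q.Z i y) < ε) ∧
  ∀ i x, ∀ z ∈ Q.Z i x, κ₀ ≤ Q.K i x z

/-- Assumption (H.3): `λ₀ > sup_{i,α} ([σ^α_i]₁² + [b^α_i]₁)`. -/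
def H3 (P : HJBData d d' M 𝒜) (lam0 : ℝ) : Prop :=
  ∃ Kσ Kb : ℝ, 0 ≤ Kσ ∧ 0 ≤ Kb ∧ Kσ ^ 2 + Kb < lam0 ∧
    ∀ i, ∀ α ∈ P.A i,
      (∀ x y, frobNorm (P.σm i α x - P.σm i α y) ≤ Kσ * ‖x - y‖) ∧
      ∀ x y, ‖P.bv i α x - P.bv i α y‖ ≤ Kb * ‖x - y‖

/-- Assumption (H.4): the intervention operator preserves Lipschitz functions,
`[M_i u]₁ ≤ sup_j [u_j]₁ + C`. -/
def H4 (Q : ImpulseData d M 𝒵) (C : ℝ) : Prop :=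
  0 ≤ C ∧ ∀ u : Fin M → E d → ℝ, (∀ i, InC01 (u i)) →
    ∀ L : ℝ, 0 ≤ L → (∀ i x y, |u i x - u i y| ≤ L * ‖x - y‖) →
      ∀ i x y, |Q.Mop i u x - Q.Mop i u y| ≤ (L + C) * ‖x - y‖

/-- `C¹` regularity with bounded and Lipschitz derivative. -/
def C1Bound {F : Type} [NormedAddCommGroup F] [NormedSpace ℝ F] (f : E d → F) (C : ℝ) : Prop :=
  ContDiff ℝ 1 f ∧ (∀ x, ‖fderiv ℝ f x‖ ≤ C) ∧
    ∀ x y, ‖fderiv ℝ f x - fderiv ℝ f y‖ ≤ C * ‖x - y‖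

/-- Assumption (H.5). -/
def H5 (P : HJBData d d' M 𝒜) (C : ℝ) : Prop :=
  ∀ i, ∀ α ∈ P.A i,
    (∀ k l, C1Bound (fun x => P.σm i α x k l) C) ∧
    C1Bound (P.bv i α) C ∧ C1Bound (P.cz i α) C ∧
    (∀ j, C1Bound (P.dcp i j α) C) ∧
    Semiconcave (P.runCost i α) C

/-- Assumption (H.6): the intervention operator preserves semiconcave functions,
`[M_i u]_{2,+} ≤ sup_j [u_j]_{2,+} + C`. -/
def H6 (Q : ImpulseData d M 𝒵) (C : ℝ) : Prop :=
  0 ≤ C ∧ ∀ u : Fin M → E d → ℝ, (∀ i, Continuous (u i)) → (∃ B, ∀ i x, |u i x| ≤ B) →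
    ∀ Cu : ℝ, 0 ≤ Cu → (∀ i, Semiconcave (u i) Cu) →
      ∀ i, Semiconcave (fun x => Q.Mop i u x) (Cu + C)

/-- Switching intervention operator `(M_i u)(x) = min_{j ≠ i} [u_j(x) + k_{ij}(x)]`. -/
def Msw (k : Fin M → Fin M → E d → ℝ) (i : Fin M) (u : Fin M → E d → ℝ) (x : E d) : ℝ :=
  sInf ((fun j => u j x + k i j x) '' {j | j ≠ i})

/-- The switching HJBQVI operator. -/
def Fsw (P : HJBData d d' M 𝒜) (k : Fin M → Fin M → E d → ℝ) : Op d M :=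
  fun i x u p X => max (P.Ham i x (fun j => u j x) p X) (u i x - Msw k i u x)

/-- The componentwise penalized switching system operator. -/
def FswPen (P : HJBData d d' M 𝒜) (k : Fin M → Fin M → E d → ℝ) (ρ : ℝ) : Op d M :=
  fun i x u p X => P.Ham i x (fun j => u j x) p X
    + ρ * ∑ j ∈ Finset.univ.erase i, max (u i x - u j x - k i j x) 0

/-- Assumption (H.7) on signed switching costs. -/
def H7 (k : Fin M → Fin M → E d → ℝ) (κ₀ C : ℝ) : Prop :=
  0 < κ₀ ∧ 0 ≤ C ∧
  (∀ i x, k i i x = 0) ∧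
  (∀ i j l, j ≠ i → ∀ x : E d, κ₀ ≤ k i j x + k j l x - k i l x) ∧
  (∀ i j, (∀ x, |k i j x| ≤ C) ∧ ∀ x y, |k i j x - k i j y| ≤ C * ‖x - y‖) ∧
  ∀ i j (x : E d), k i j x < κ₀ → ∃ h₀ > (0 : ℝ), ∀ h : E d, ‖h‖ < h₀ →
    k i j (x + h) - 2 * k i j x + k i j (x - h) ≤ C * ‖h‖ ^ 2

/-- `k̃_i = min{min_{j≠i}(k_{ji} − ε), 0}`. -/
def ktil (k : Fin M → Fin M → E d → ℝ) (ε : ℝ) (i : Fin M) (x : E d) : ℝ :=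
  sInf (insert 0 ((fun j => k j i x - ε) '' {j | j ≠ i}))

/-- Strict viscosity subsolution with margin `g`: `F_i(x, u, Dφ, D²φ) ≤ g` at
every local maximum of `u_i − φ`. -/
def IsStrictSubsolution (F : Op d M) (g : ℝ) (u : Fin M → E d → ℝ) : Prop :=
  (∀ i, UpperSemicontinuous (u i)) ∧
  ∀ (i : Fin M) (φ : E d → ℝ), ContDiff ℝ 2 φ → ∀ x : E d,
    IsLocalMax (fun y => u i y - φ y) x → F i x u (gradient φ x) (hess φ x) ≤ g

/-- Half-relaxed upper limit `u*(x) = limsup_{ρ→∞, y→x} u^ρ(y)`. -/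
def relaxSup (u : ℕ → E d → ℝ) (x : E d) : ℝ :=
  Filter.limsup (fun p : ℕ × E d => u p.1 p.2) (Filter.atTop ×ˢ nhds x)

/-- Half-relaxed lower limit `u_*(x) = liminf_{ρ→∞, y→x} u^ρ(y)`. -/
def relaxInf (u : ℕ → E d → ℝ) (x : E d) : ℝ :=
  Filter.liminf (fun p : ℕ × E d => u p.1 p.2) (Filter.atTop ×ˢ nhds x)

/-- Set of optimal impulse controls `𝒵^v_i(x)`. -/
def argminSet (Q : ImpulseData d M 𝒵) (v : Fin M → E d → ℝ) (i : Fin M) (x : E d) : Set 𝒵 :=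
  {z | z ∈ Q.Z i x ∧ ∀ z' ∈ Q.Z i x,
    v i (Q.Γ i x z) + Q.K i x z ≤ v i (Q.Γ i x z') + Q.K i x z'}

section SecondOrder

variable {V : Type*} [NormedAddCommGroup V] [InnerProductSpace ℝ V]

/-- `g` is a subgradient of `W` at `x`, up to a concave quadratic of size `lam`. -/
def SubgradAt (lam : ℝ) (W : V → ℝ) (x g : V) : Prop :=
  ∀ y, W x + ⟪g, y - x⟫ - lam * ‖y - x‖ ^ 2 ≤ W y

/-- The affine function through `(x, W x)` with slope `p` lies above `W`. -/
def TopAt (W : V → ℝ) (x p : V) : Prop :=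
  ∀ y, W y ≤ W x + ⟪p, y - x⟫

lemma norm_le_of_inner_le {lam t : ℝ} (hlam : 0 < lam) (ht : 0 ≤ t) (e : V)
    (h : ∀ v : V, ⟪e, v⟫ ≤ lam * (‖v‖ ^ 2 + t ^ 2)) : ‖e‖ ≤ 2 * lam * t := by
  have h1 := h ((1 / (2 * lam)) • e)
  rw [inner_smul_right, real_inner_self_eq_norm_sq, norm_smul, Real.norm_of_nonneg (by positivity)]
    at h1
  have h2 : ‖e‖ ^ 2 ≤ (2 * lam * t) ^ 2 := by
    have e1 : 1 / (2 * lam) * ‖e‖ ^ 2 = ‖e‖ ^ 2 / (2 * lam) := by ring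
    have e2 : lam * ((1 / (2 * lam) * ‖e‖) ^ 2 + t ^ 2)
        = ‖e‖ ^ 2 / (4 * lam) + lam * t ^ 2 := by field_simp; ring
    rw [e1, e2] at h1
    have e3 : ‖e‖ ^ 2 / (2 * lam) - ‖e‖ ^ 2 / (4 * lam) = ‖e‖ ^ 2 / (4 * lam) := by
      field_simp; ring
    have h3 : ‖e‖ ^ 2 / (4 * lam) ≤ lam * t ^ 2 := by linarith
    rw [div_le_iff₀ (by positivity)] at h3
    nlinarith
  exact abs_le_of_sq_le_sq' h2 (by positivity) |>.2

lemma SubgradAt.eq_of_topAt {lam : ℝ} (hlam : 0 < lam) {W : V → ℝ} {x g p : V}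
    (hg : SubgradAt lam W x g) (hp : TopAt W x p) : g = p := by
  have := norm_le_of_inner_le hlam le_rfl (g - p) (fun v => by
    have h1 := hg (x + v)
    have h2 := hp (x + v)
    simp only [add_sub_cancel_left] at h1 h2
    rw [inner_sub_left]; nlinarith)
  simp only [mul_zero] at this
  exact sub_eq_zero.1 (norm_le_zero_iff.1 this)

lemma SubgradAt.norm_sub_le_of_topAt {lam : ℝ} (hlam : 0 < lam) {W : V → ℝ} {x y g p g' : V}
    (hg : SubgradAt lam W x g) (hp : TopAt W y p) (hg' : SubgradAt lam W y g') :
    ‖g - p‖ ≤ 2 * lam * ‖x - y‖ := by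
  obtain rfl := hg'.eq_of_topAt hlam hp
  refine norm_le_of_inner_le hlam (norm_nonneg _) _ fun v => ?_
  have h1 := hg (x + v)
  have h2 := hp (x + v)
  have h3 := hg' x
  rw [add_sub_cancel_left] at h1
  rw [add_sub_right_comm, inner_add_right] at h2
  rw [inner_sub_left]; linarith

/-- A function whose approximate subgradients are differentiable at a point has a second-order
Taylor expansion there. -/
lemma taylor_of_subgrad {lam : ℝ} (hlam : 0 < lam) {W : V → ℝ} {g : V → V}
    (hg : ∀ x, SubgradAt lam W x (g x)) {x p : V} {A : V →L[ℝ] V}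
    (hA : ∀ η > (0 : ℝ), ∀ᶠ y in 𝓝 x, ‖g y - p - A (y - x)‖ ≤ η * ‖y - x‖) :
    ∀ η > (0 : ℝ), ∀ᶠ h in 𝓝 (0 : V),
      |W (x + h) - W x - ⟪p, h⟫ - 1 / 2 * ⟪A h, h⟫| ≤ η * ‖h‖ ^ 2 := by
  intro η hη
  obtain ⟨N, hN⟩ := exists_nat_gt ((2 * lam + ‖A‖) / η)
  have hN0 : (0 : ℝ) < N := lt_of_le_of_lt (by positivity) hN
  obtain ⟨r, hr, hball⟩ := Metric.eventually_nhds_iff.1 (hA (η / 2) (by positivity))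
  filter_upwards [Metric.ball_mem_nhds (0 : V) hr] with h hh
  rw [mem_ball_zero_iff] at hh
  set s : ℝ := 1 / N with hs
  have hs0 : 0 < s := by positivity
  have hNs : N * s = 1 := by rw [hs]; field_simp
  have key : ∀ k : ℕ, k ≤ N → |⟪g (x + (k * s) • h), h⟫ - ⟪p, h⟫ - k * s * ⟪A h, h⟫|
      ≤ η / 2 * ‖h‖ ^ 2 := by
    intro k hk
    have hks : (k : ℝ) * s ≤ 1 := by
      rw [← hNs]; gcongr
    have hks0 : 0 ≤ (k : ℝ) * s := by positivity
    have hn : ‖((k : ℝ) * s) • h‖ ≤ ‖h‖ := by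
      rw [norm_smul, Real.norm_of_nonneg hks0]
      exact mul_le_of_le_one_left (norm_nonneg _) hks
    have h1 := @hball (x + ((k : ℝ) * s) • h) (by
      rw [dist_eq_norm, add_sub_cancel_left]; exact hn.trans_lt hh)
    rw [add_sub_cancel_left] at h1
    have h2 : ⟪g (x + (k * s) • h), h⟫ - ⟪p, h⟫ - k * s * ⟪A h, h⟫
        = ⟪g (x + (k * s) • h) - p - A ((k * s) • h), h⟫ := by
      rw [inner_sub_left, inner_sub_left, map_smul, real_inner_smul_left]
    rw [h2]
    calc _ ≤ ‖g (x + (k * s) • h) - p - A ((k * s) • h)‖ * ‖h‖ := abs_real_inner_le_norm _ _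
      _ ≤ (η / 2 * ‖h‖) * ‖h‖ := by gcongr; exact h1.trans (by gcongr)
      _ = _ := by ring
  have step : ∀ k : ℕ, (x + ((k + 1 : ℕ) * s) • h) - (x + (k * s) • h) = s • h := by
    intro k; push_cast; module
  have nsq : ‖s • h‖ ^ 2 = s ^ 2 * ‖h‖ ^ 2 := by
    rw [norm_smul, mul_pow, Real.norm_of_nonneg hs0.le]
  have lower : ∀ k : ℕ, k ≤ N → W x + k * s * ⟪p, h⟫ + k * (k - 1) / 2 * s ^ 2 * ⟪A h, h⟫
      - k * s * (η / 2 * ‖h‖ ^ 2) - k * lam * s ^ 2 * ‖h‖ ^ 2 ≤ W (x + (k * s) • h) := by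
    intro k
    induction k with
    | zero => intro _; simp
    | succ k ih =>
      intro hk
      have i1 := ih (by omega)
      have i2 := hg (x + (k * s) • h) (x + ((k + 1 : ℕ) * s) • h)
      rw [step, inner_smul_right, nsq] at i2
      have i3 := (abs_le.1 (key k (by omega))).1
      have i4 := mul_le_mul_of_nonneg_left i3 hs0.le
      refine le_trans ?_ i2
      push_cast
      nlinarith
  have upper : ∀ k : ℕ, k ≤ N → W (x + (k * s) • h) ≤
      W x + k * s * ⟪p, h⟫ + k * (k + 1) / 2 * s ^ 2 * ⟪A h, h⟫
      + k * s * (η / 2 * ‖h‖ ^ 2) + k * lam * s ^ 2 * ‖h‖ ^ 2 := by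
    intro k
    induction k with
    | zero => intro _; simp
    | succ k ih =>
      intro hk
      have i1 := ih (by omega)
      have i2 := hg (x + ((k + 1 : ℕ) * s) • h) (x + (k * s) • h)
      rw [← neg_sub (x + ((k + 1 : ℕ) * s) • h), step, inner_neg_right, norm_neg, inner_smul_right,
        nsq] at i2
      have i3 := (abs_le.1 (key (k + 1) hk)).2
      have i4 := mul_le_mul_of_nonneg_left i3 hs0.le
      push_cast at i1 i2 i4 ⊢
      nlinarith
  have l := lower N le_rfl
  have u := upper N le_rfl
  rw [hNs, one_smul] at l u
  have hAh : |⟪A h, h⟫| ≤ ‖A‖ * ‖h‖ ^ 2 := by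
    calc _ ≤ ‖A h‖ * ‖h‖ := abs_real_inner_le_norm _ _
      _ ≤ (‖A‖ * ‖h‖) * ‖h‖ := by gcongr; exact A.le_opNorm h
      _ = _ := by ring
  have hsη : s * (lam + ‖A‖ / 2) ≤ η / 2 := by
    rw [div_lt_iff₀ hη] at hN
    rw [hs, one_div, inv_mul_le_iff₀ hN0]; linarith
  have hfin := mul_le_mul_of_nonneg_right hsη (sq_nonneg ‖h‖)
  have e1 : (N : ℝ) * (N - 1) / 2 * s ^ 2 = 1 / 2 - s / 2 := by
    have : (N : ℝ) * (N - 1) / 2 * s ^ 2 = (N * s) ^ 2 / 2 - (N * s) * s / 2 := by ring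
    rw [this, hNs]; ring
  have e2 : (N : ℝ) * (N + 1) / 2 * s ^ 2 = 1 / 2 + s / 2 := by
    have : (N : ℝ) * (N + 1) / 2 * s ^ 2 = (N * s) ^ 2 / 2 + (N * s) * s / 2 := by ring
    rw [this, hNs]; ring
  have e3 : (N : ℝ) * lam * s ^ 2 = lam * s := by
    have : (N : ℝ) * lam * s ^ 2 = (N * s) * lam * s := by ring
    rw [this, hNs]; ring
  rw [e1, e3] at l
  rw [e2, e3] at u
  have hA2 := mul_le_mul_of_nonneg_left hAh hs0.le
  have hA3 := abs_mul s ⟪A h, h⟫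
  rw [abs_of_pos hs0] at hA3
  rw [← hA3] at hA2
  have hA4 := abs_le.1 hA2
  rw [abs_le]
  constructor <;> nlinarith [hA4.1, hA4.2]

variable [FiniteDimensional ℝ V]

open MeasureTheory Module in
/-- Near a density point of a set, every point is close to the set. -/
lemma eventually_near_of_density [MeasurableSpace V] [BorelSpace V] (μ : Measure V)
    [μ.IsAddHaarMeasure] {K : Set V} {x : V} (hx : x ∈ K)
    (hd : Tendsto (fun r => μ (K ∩ Metric.closedBall x r) / μ (Metric.closedBall x r))
      (𝓝[>] 0) (𝓝 1)) {η : ℝ} (hη : 0 < η) :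
    ∀ᶠ y in 𝓝 x, ∃ k ∈ K, ‖y - k‖ ≤ η * ‖y - x‖ := by
  wlog hη1 : η ≤ 1 generalizing η
  · filter_upwards [this one_pos le_rfl] with y ⟨k, hk, hky⟩
    exact ⟨k, hk, hky.trans (by gcongr; exact (not_le.1 hη1).le)⟩
  set n := finrank ℝ V
  have hlt : (1 - ENNReal.ofReal ((η / 2) ^ n) : ENNReal) < 1 :=
    ENNReal.sub_lt_self ENNReal.one_ne_top one_ne_zero (by
      simp only [ne_eq, ENNReal.ofReal_eq_zero, not_le]; positivity)
  have h1 := hd.eventually (lt_mem_nhds hlt)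
  obtain ⟨r, hr, hball⟩ := Metric.eventually_nhds_iff.1 (eventually_nhdsWithin_iff.1 h1)
  filter_upwards [Metric.ball_mem_nhds x (half_pos hr)] with y hy
  by_contra! hcon
  have hyx : y ≠ x := by
    rintro rfl
    have := hcon y hx
    simp at this
  have ht : 0 < ‖y - x‖ := norm_pos_iff.2 (sub_ne_zero.2 hyx)
  set t := ‖y - x‖
  have hy' : t < r / 2 := by simpa [t, dist_eq_norm] using hy
  have h2 := @hball (2 * t) (by
    rw [Real.dist_eq, sub_zero, abs_of_pos (by positivity)]; linarith) (by
    simp only [Set.mem_Ioi]; positivity)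
  have hsub : Metric.closedBall y (η * t) ⊆ Metric.closedBall x (2 * t) := by
    intro z hz
    rw [Metric.mem_closedBall] at hz ⊢
    calc dist z x ≤ dist z y + dist y x := dist_triangle _ _ _
      _ ≤ η * t + t := by gcongr; rw [dist_eq_norm]
      _ ≤ 2 * t := by nlinarith
  have hKs : K ∩ Metric.closedBall x (2 * t) ⊆
      Metric.closedBall x (2 * t) \ Metric.closedBall y (η * t) := by
    rintro k ⟨hk, hk2⟩
    refine ⟨hk2, fun hk3 => ?_⟩
    rw [Metric.mem_closedBall, dist_comm, dist_eq_norm] at hk3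
    exact absurd (hcon k hk) (not_lt.2 hk3)
  have hpos : μ (Metric.closedBall x (2 * t)) ≠ 0 :=
    (Metric.measure_closedBall_pos μ x (by positivity)).ne'
  have hfin : μ (Metric.closedBall x (2 * t)) ≠ ⊤ := measure_closedBall_lt_top.ne
  have hratio : μ (Metric.closedBall y (η * t)) =
      ENNReal.ofReal ((η / 2) ^ n) * μ (Metric.closedBall x (2 * t)) := by
    rw [Measure.addHaar_closedBall μ y (by positivity),
      Measure.addHaar_closedBall μ x (by positivity), ← mul_assoc,
      ← ENNReal.ofReal_mul (by positivity), ← mul_pow]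
    congr 3; ring
  have h3 : μ (K ∩ Metric.closedBall x (2 * t)) ≤
      (1 - ENNReal.ofReal ((η / 2) ^ n)) * μ (Metric.closedBall x (2 * t)) := by
    refine (measure_mono hKs).trans ?_
    rw [measure_sdiff hsub Metric.isClosed_closedBall.measurableSet.nullMeasurableSet
      measure_closedBall_lt_top.ne, hratio, ENNReal.sub_mul (fun _ _ => hfin), one_mul]
  exact absurd (ENNReal.div_le_of_le_mul h3) (not_le.2 h2)

open MeasureTheory Module in
/-- Jensen's lemma combined with Alexandrov's theorem: a semiconvex function whose small linear
perturbations attain their maximum has a second-order Taylor expansion at a maximum point of some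
such perturbation. -/
theorem exists_taylor_at_perturbed_max {lam δ : ℝ} (hlam : 0 < lam) (hδ : 0 < δ) {W : V → ℝ}
    (hsub : ∀ x, ∃ g, SubgradAt lam W x g)
    (hmax : ∀ p : V, ‖p‖ < δ → ∃ x, TopAt W x p) :
    ∃ (p x : V) (A : V →L[ℝ] V), ‖p‖ < δ ∧ TopAt W x p ∧
      ∀ η > (0 : ℝ), ∀ᶠ h in 𝓝 (0 : V),
        |W (x + h) - W x - ⟪p, h⟫ - 1 / 2 * ⟪A h, h⟫| ≤ η * ‖h‖ ^ 2 := by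
  let _ : MeasurableSpace V := borel V
  have _ : BorelSpace V := ⟨rfl⟩
  choose g hg using hsub
  set K : Set V := {x | ‖g x‖ < δ ∧ TopAt W x (g x)} with hK
  have hgp : ∀ {x p}, TopAt W x p → g x = p := fun h => (hg _).eq_of_topAt hlam h
  have hlip : LipschitzOnWith (Real.toNNReal (2 * lam)) g K := by
    refine LipschitzOnWith.of_dist_le_mul fun x _ y hy => ?_
    rw [Real.coe_toNNReal _ (by positivity), dist_eq_norm, dist_eq_norm]
    exact (hg x).norm_sub_le_of_topAt hlam hy.2 (hg y)
  have himg : Metric.ball (0 : V) δ ⊆ g '' K := by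
    intro p hp
    rw [mem_ball_zero_iff] at hp
    obtain ⟨x, hx⟩ := hmax p hp
    have := hgp hx
    exact ⟨x, ⟨by rwa [this], by rwa [this]⟩, this⟩
  set μ : Measure V := Measure.hausdorffMeasure (finrank ℝ V) with hμ
  have hKpos : μ K ≠ 0 := by
    intro h0
    have h1 := hlip.hausdorffMeasure_image_le (d := finrank ℝ V) (by positivity)
    rw [← hμ, h0, mul_zero] at h1
    exact absurd ((measure_mono himg).trans h1) (not_le.2 (Metric.measure_ball_pos μ 0 hδ))
  have hdiff : ∀ᵐ x ∂μ.restrict K, x ∈ K → DifferentiableWithinAt ℝ g K x :=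
    ae_restrict_of_ae hlip.ae_differentiableWithinAt_of_mem
  obtain ⟨x, hxK, hdens, h2⟩ := Measure.exists_mem_of_measure_ne_zero_of_ae hKpos
    ((Besicovitch.ae_tendsto_measure_inter_div μ K).and hdiff)
  have hD := h2 hxK
  set A := fderivWithin ℝ g K x
  have hA : HasFDerivWithinAt g A K x := hD.hasFDerivWithinAt
  refine ⟨g x, x, A, hxK.1, hxK.2, taylor_of_subgrad hlam hg fun η hη => ?_⟩
  obtain ⟨r, hr, hball⟩ := Metric.eventually_nhds_iff.1
    (eventually_nhdsWithin_iff.1 (hA.isLittleO.def (show (0 : ℝ) < η / 4 by positivity)))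
  set c := min 1 (η / (2 * (2 * lam + ‖A‖)))
  have hc : 0 < c := by positivity
  have hc2 : (2 * lam + ‖A‖) * c ≤ η / 2 := by
    have : c ≤ η / (2 * (2 * lam + ‖A‖)) := min_le_right _ _
    rw [le_div_iff₀ (by positivity)] at this
    linarith
  filter_upwards [eventually_near_of_density μ hxK hdens hc,
    Metric.ball_mem_nhds x (half_pos hr)] with y ⟨k, hk, hyk⟩ hy
  have hy' : ‖y - x‖ < r / 2 := by simpa [dist_eq_norm] using hy
  have hky : ‖y - k‖ ≤ ‖y - x‖ :=
    hyk.trans (mul_le_of_le_one_left (norm_nonneg _) (min_le_left _ _))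
  have hkx : ‖k - x‖ ≤ 2 * ‖y - x‖ := by
    calc ‖k - x‖ = ‖(y - x) - (y - k)‖ := by congr 1; abel
      _ ≤ ‖y - x‖ + ‖y - k‖ := norm_sub_le _ _
      _ ≤ _ := by linarith
  have h3 : ‖g k - g x - A (k - x)‖ ≤ η / 4 * ‖k - x‖ :=
    @hball k (by rw [dist_eq_norm]; linarith) hk
  have h4 := (hg y).norm_sub_le_of_topAt hlam hk.2 (hg k)
  have h5 : ‖A (k - y)‖ ≤ ‖A‖ * ‖y - k‖ := by
    rw [norm_sub_rev y k]; exact A.le_opNorm _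
  calc ‖g y - g x - A (y - x)‖ = ‖(g y - g k) + (g k - g x - A (k - x)) + A (k - y)‖ := by
        congr 1; simp only [map_sub]; abel
    _ ≤ ‖g y - g k‖ + ‖g k - g x - A (k - x)‖ + ‖A (k - y)‖ := norm_add₃_le
    _ ≤ 2 * lam * ‖y - k‖ + η / 4 * (2 * ‖y - x‖) + ‖A‖ * ‖y - k‖ := by
        gcongr; exact h3.trans (by gcongr)
    _ = (2 * lam + ‖A‖) * ‖y - k‖ + η / 2 * ‖y - x‖ := by ring
    _ ≤ (2 * lam + ‖A‖) * (c * ‖y - x‖) + η / 2 * ‖y - x‖ := by gcongr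
    _ = (2 * lam + ‖A‖) * c * ‖y - x‖ + η / 2 * ‖y - x‖ := by ring
    _ ≤ η / 2 * ‖y - x‖ + η / 2 * ‖y - x‖ := by gcongr
    _ = η * ‖y - x‖ := by ring

end SecondOrder

lemma exists_forall_sub_le {T : Type*} [TopologicalSpace T] [Nonempty T] {f q : T → ℝ} {B : ℝ}
    (hf : UpperSemicontinuous f) (hB : ∀ t, |f t| ≤ B) (hq : Continuous q)
    (hcpt : ∀ c, ∃ K, IsCompact K ∧ ∀ t, q t ≤ c → t ∈ K) :
    ∃ t, ∀ s, f s - q s ≤ f t - q t := by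
  obtain ⟨t₀⟩ := ‹Nonempty T›
  obtain ⟨K, hK, hmem⟩ := hcpt (q t₀ + 2 * B)
  have hB0 : 0 ≤ B := (abs_nonneg _).trans (hB t₀)
  have ht₀ : t₀ ∈ K := hmem _ (by linarith)
  have husc : UpperSemicontinuous fun t => f t - q t := by
    simp only [sub_eq_add_neg]
    exact hf.add hq.neg.upperSemicontinuous
  obtain ⟨t, -, ht⟩ := (husc.upperSemicontinuousOn K).exists_isMaxOn ⟨t₀, ht₀⟩ hK
  refine ⟨t, fun s => ?_⟩
  by_cases hs : s ∈ K
  · exact ht hs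
  · have h1 : q t₀ + 2 * B < q s := lt_of_not_ge fun h => hs (hmem s h)
    have h2 : f t₀ - q t₀ ≤ f t - q t := ht ht₀
    have h3 := abs_le.1 (hB s)
    have h4 := abs_le.1 (hB t₀)
    linarith

section Ishii

variable {F : Type*} [NormedAddCommGroup F] [InnerProductSpace ℝ F]

/-- The quadratic polynomial based at `x` with slope `P` and second derivative `X`. -/
def quadTest (x P : F) (X : F →L[ℝ] F) (y : F) : ℝ :=
  ⟪P, y - x⟫ + 1 / 2 * ⟪X (y - x), y - x⟫

/-- The sup-convolution of `w` evaluated along a choice `α` of maximizers. -/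
def supConv (κ : ℝ) (w : F → ℝ) (α : F → F) (x : F) : ℝ := w (α x) - κ * ‖x - α x‖ ^ 2

/-- `α x` maximizes `w · - κ ‖x - ·‖ ^ 2`. -/
def IsMaximizer (κ : ℝ) (w : F → ℝ) (α : F → F) : Prop :=
  ∀ x y, w y - κ * ‖x - y‖ ^ 2 ≤ supConv κ w α x

/-- The doubled functional of two sup-convolutions, localized near `x₀`. -/
def doubled (κ β : ℝ) (x₀ : F) (w z : F → ℝ) (α γ : F → F) (ζ : WithLp 2 (F × F)) : ℝ :=
  supConv κ w α ζ.fst + supConv κ z γ ζ.snd - κ * ‖ζ.fst - ζ.snd‖ ^ 2 - β * ‖ζ.fst - x₀‖ ^ 2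

lemma exists_isMaximizer [FiniteDimensional ℝ F] {κ B : ℝ} (hκ : 0 < κ) {w : F → ℝ}
    (hw : UpperSemicontinuous w) (hB : ∀ x, |w x| ≤ B) : ∃ α, IsMaximizer κ w α := by
  have : ProperSpace F := FiniteDimensional.proper_real F
  have h : ∀ x, ∃ a, ∀ y, w y - κ * ‖x - y‖ ^ 2 ≤ w a - κ * ‖x - a‖ ^ 2 := fun x => by
    refine exists_forall_sub_le hw hB (by fun_prop) fun c => ?_
    refine ⟨Metric.closedBall x (c / κ + 1), isCompact_closedBall _ _, fun t ht => ?_⟩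
    have : ‖x - t‖ ^ 2 ≤ c / κ := by rw [le_div_iff₀ hκ]; linarith
    rw [Metric.mem_closedBall', dist_eq_norm]
    nlinarith [norm_nonneg (x - t)]
  choose α hα using h
  exact ⟨α, fun x y => hα x y⟩

lemma IsMaximizer.le_supConv_add {κ : ℝ} {w : F → ℝ} {α : F → F} (h : IsMaximizer κ w α)
    (x e : F) : supConv κ w α x - 2 * κ * ⟪x - α x, e⟫ - κ * ‖e‖ ^ 2 ≤ supConv κ w α (x + e) := by
  have := h (x + e) (α x)
  rw [add_sub_right_comm, norm_add_sq_real] at this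
  rw [supConv]; linarith

lemma IsMaximizer.le_supConv_add' {G : Type*} [NormedAddCommGroup G] {κ : ℝ} {w : G → ℝ}
    {α : G → G} (h : IsMaximizer κ w α) (x e : G) :
    w (α x + e) - κ * ‖x - α x‖ ^ 2 ≤ supConv κ w α (x + e) := by
  have := h (x + e) (α x + e)
  rwa [add_sub_add_right_eq_sub] at this

lemma norm_sub_sq_le_two (h k : F) : ‖h - k‖ ^ 2 ≤ 2 * (‖h‖ ^ 2 + ‖k‖ ^ 2) := by
  have := norm_add_sq_real h k
  have := norm_sub_sq_real h k
  nlinarith [sq_nonneg ‖h + k‖]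

lemma inner_eq_fst_add_snd (p q : WithLp 2 (F × F)) :
    ⟪p, q⟫ = ⟪p.fst, q.fst⟫ + ⟪p.snd, q.snd⟫ := WithLp.prod_inner_apply p q

lemma doubled_subgradAt {κ β : ℝ} (hκ : 0 < κ) (hβ : 0 < β) {x₀ : F} {w z : F → ℝ} {α γ : F → F}
    (hα : IsMaximizer κ w α) (hγ : IsMaximizer κ z γ) (ζ : WithLp 2 (F × F)) :
    ∃ g, SubgradAt (3 * κ + β) (doubled κ β x₀ w z α γ) ζ g := by
  refine ⟨WithLp.toLp 2 (-(2 * κ) • (ζ.fst - α ζ.fst) - (2 * κ) • (ζ.fst - ζ.snd)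
      - (2 * β) • (ζ.fst - x₀), -(2 * κ) • (ζ.snd - γ ζ.snd) + (2 * κ) • (ζ.fst - ζ.snd)),
    fun y => ?_⟩
  obtain ⟨e, rfl⟩ : ∃ e, y = ζ + e := ⟨y - ζ, by abel⟩
  rw [add_sub_cancel_left, inner_eq_fst_add_snd, WithLp.prod_norm_sq_eq_of_L2]
  have h1 := hα.le_supConv_add ζ.fst e.fst
  have h2 := hγ.le_supConv_add ζ.snd e.snd
  have h3 := norm_add_sq_real (ζ.fst - ζ.snd) (e.fst - e.snd)
  have h4 := norm_add_sq_real (ζ.fst - x₀) e.fst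
  rw [← add_sub_add_comm] at h3
  rw [← add_sub_right_comm] at h4
  have h5 := norm_sub_sq_le_two e.fst e.snd
  simp only [doubled, WithLp.add_fst, WithLp.add_snd, h3, h4, WithLp.toLp_fst, WithLp.toLp_snd]
  simp only [inner_add_left, inner_sub_left, real_inner_smul_left, inner_sub_right] at h1 h2 ⊢
  have h6 := mul_le_mul_of_nonneg_left h5 hκ.le
  nlinarith [mul_nonneg hβ.le (sq_nonneg ‖e.snd‖)]

/-- The penalization used to double variables, tilted by a small linear form `(p, r)`. -/
def doublingPenalty (κ β : ℝ) (x₀ p r x y a b : F) : ℝ :=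
  κ * ‖x - a‖ ^ 2 + κ * ‖y - b‖ ^ 2 + κ * ‖x - y‖ ^ 2 + β * ‖x - x₀‖ ^ 2
    + ⟪p, x - x₀⟫ + ⟪r, y - x₀⟫

lemma le_doublingPenalty {κ β τ δ : ℝ} (hκ : 0 < κ) (hβ : 0 < β)
    (hδτ : 2 * δ ^ 2 / β + δ ^ 2 / (2 * κ) ≤ τ) {p r : F} (hp : ‖p‖ ≤ δ) (hr : ‖r‖ ≤ δ)
    (x₀ x y a b : F) :
    κ / 2 * (‖x - a‖ ^ 2 + ‖y - b‖ ^ 2 + ‖x - y‖ ^ 2) + β / 2 * ‖x - x₀‖ ^ 2 - τ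
      ≤ doublingPenalty κ β x₀ p r x y a b := by
  have h1 := abs_le.1 ((abs_real_inner_le_norm p (x - x₀)).trans
    (mul_le_mul_of_nonneg_right hp (norm_nonneg _)))
  have h2 := abs_le.1 ((abs_real_inner_le_norm r (y - x₀)).trans
    (mul_le_mul_of_nonneg_right hr (norm_nonneg _)))
  have h3 : ‖y - x₀‖ ≤ ‖x - x₀‖ + ‖x - y‖ := by
    rw [add_comm, norm_sub_rev x y]; exact norm_sub_le_norm_sub_add_norm_sub _ _ _
  have hδ : 0 ≤ δ := (norm_nonneg _).trans hp
  have h4 := mul_le_mul_of_nonneg_left h3 hδ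
  have h5 : β / 2 * ‖x - x₀‖ ^ 2 - 2 * δ * ‖x - x₀‖ + 2 * δ ^ 2 / β
      = (β * ‖x - x₀‖ - 2 * δ) ^ 2 / (2 * β) := by field_simp; ring
  have h6 : κ / 2 * ‖x - y‖ ^ 2 - δ * ‖x - y‖ + δ ^ 2 / (2 * κ)
      = (κ * ‖x - y‖ - δ) ^ 2 / (2 * κ) := by field_simp; ring
  have h7 : 0 ≤ (β * ‖x - x₀‖ - 2 * δ) ^ 2 / (2 * β) := by positivity
  have h8 : 0 ≤ (κ * ‖x - y‖ - δ) ^ 2 / (2 * κ) := by positivity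
  have h9 : 0 ≤ κ * ‖x - a‖ ^ 2 := by positivity
  have h10 : 0 ≤ κ * ‖y - b‖ ^ 2 := by positivity
  rw [doublingPenalty]; linarith

lemma doubled_topAt [FiniteDimensional ℝ F] {κ β τ δ B B' : ℝ} (hκ : 0 < κ) (hβ : 0 < β)
    (hδτ : 2 * δ ^ 2 / β + δ ^ 2 / (2 * κ) ≤ τ) {x₀ : F} {w z : F → ℝ}
    {α γ : F → F} (hα : IsMaximizer κ w α) (hγ : IsMaximizer κ z γ)
    (hw : UpperSemicontinuous w) (hB : ∀ x, |w x| ≤ B)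
    (hz : UpperSemicontinuous z) (hB' : ∀ x, |z x| ≤ B')
    (p : WithLp 2 (F × F)) (hp : ‖p‖ < δ) : ∃ ξ, TopAt (doubled κ β x₀ w z α γ) ξ p := by
  have : ProperSpace F := FiniteDimensional.proper_real F
  have hp1 : ‖p.fst‖ ≤ δ := (WithLp.norm_fst_le _ _).trans hp.le
  have hp2 : ‖p.snd‖ ≤ δ := (WithLp.norm_snd_le _ _).trans hp.le
  obtain ⟨⟨⟨x, y⟩, a, b⟩, hmax⟩ := exists_forall_sub_le (T := (F × F) × F × F)
    (f := fun t => w t.2.1 + z t.2.2) (B := B + B')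
    (q := fun t => doublingPenalty κ β x₀ p.fst p.snd t.1.1 t.1.2 t.2.1 t.2.2)
    ((hw.comp (continuous_fst.comp continuous_snd)).add
      (hz.comp (continuous_snd.comp continuous_snd)))
    (fun t => (abs_add_le _ _).trans (add_le_add (hB _) (hB' _)))
    (by unfold doublingPenalty; fun_prop) fun c => by
      set m : ℝ := 2 * (c + τ) / κ + 1
      set m' : ℝ := 2 * (c + τ) / β + 1
      refine ⟨(Metric.closedBall x₀ m' ×ˢ Metric.closedBall x₀ (m' + m)) ×ˢ
        Metric.closedBall x₀ (m' + m) ×ˢ Metric.closedBall x₀ (m' + m + m),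
        ((isCompact_closedBall _ _).prod (isCompact_closedBall _ _)).prod
        ((isCompact_closedBall _ _).prod (isCompact_closedBall _ _)), ?_⟩
      rintro ⟨⟨x, y⟩, a, b⟩ ht
      have h0 := (le_doublingPenalty hκ hβ hδτ hp1 hp2 x₀ x y a b).trans ht
      have hk : ∀ v : F, κ / 2 * ‖v‖ ^ 2 ≤ c + τ → ‖v‖ ≤ m := fun v hv => by
        have : ‖v‖ ^ 2 ≤ 2 * (c + τ) / κ := by rw [le_div_iff₀ hκ]; linarith
        simp only [m]; nlinarith [norm_nonneg v]
      have hb : ∀ v : F, β / 2 * ‖v‖ ^ 2 ≤ c + τ → ‖v‖ ≤ m' := fun v hv => by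
        have : ‖v‖ ^ 2 ≤ 2 * (c + τ) / β := by rw [le_div_iff₀ hβ]; linarith
        simp only [m']; nlinarith [norm_nonneg v]
      have e1 : 0 ≤ κ / 2 * ‖x - a‖ ^ 2 := by positivity
      have e2 : 0 ≤ κ / 2 * ‖y - b‖ ^ 2 := by positivity
      have e3 : 0 ≤ κ / 2 * ‖x - y‖ ^ 2 := by positivity
      have e4 : 0 ≤ β / 2 * ‖x - x₀‖ ^ 2 := by positivity
      have i1 := hk (x - a) (by linarith)
      have i2 := hk (y - b) (by linarith)
      have i3 := hk (x - y) (by linarith)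
      have i4 := hb (x - x₀) (by linarith)
      rw [← dist_eq_norm] at i1 i2 i3 i4
      have j1 := dist_triangle y x x₀
      have j2 := dist_triangle a x x₀
      have j3 := dist_triangle b y x₀
      rw [dist_comm] at i1 i2 i3
      simp only [Set.mem_prod, Metric.mem_closedBall]
      exact ⟨⟨i4, by linarith⟩, by linarith, by linarith⟩
  refine ⟨WithLp.toLp 2 (x, y), fun y' => ?_⟩
  have h1 := hmax ((y'.fst, y'.snd), α y'.fst, γ y'.snd)
  have h2 := hα x a
  have h3 := hγ y b
  rw [inner_eq_fst_add_snd]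
  simp only [doublingPenalty, doubled, supConv, WithLp.sub_fst, WithLp.sub_snd,
    WithLp.toLp_fst, WithLp.toLp_snd, inner_sub_right] at h1 h2 h3 ⊢
  linarith

lemma doubled_fst {κ β : ℝ} (x₀ : F) (w z : F → ℝ) (α γ : F → F) (ξ : WithLp 2 (F × F)) (h : F) :
    doubled κ β x₀ w z α γ (ξ + WithLp.toLp 2 (h, 0)) - doubled κ β x₀ w z α γ ξ
      = supConv κ w α (ξ.fst + h) - supConv κ w α ξ.fst
        - κ * (2 * ⟪ξ.fst - ξ.snd, h⟫ + ‖h‖ ^ 2) - β * (2 * ⟪ξ.fst - x₀, h⟫ + ‖h‖ ^ 2) := by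
  have h3 := norm_add_sq_real (ξ.fst - ξ.snd) h
  have h4 := norm_add_sq_real (ξ.fst - x₀) h
  rw [← add_sub_right_comm] at h3 h4
  simp only [doubled, WithLp.add_fst, WithLp.add_snd, WithLp.toLp_fst, WithLp.toLp_snd, add_zero,
    h3, h4]
  ring

lemma doubled_snd {κ β : ℝ} (x₀ : F) (w z : F → ℝ) (α γ : F → F) (ξ : WithLp 2 (F × F)) (k : F) :
    doubled κ β x₀ w z α γ (ξ + WithLp.toLp 2 (0, k)) - doubled κ β x₀ w z α γ ξ
      = supConv κ z γ (ξ.snd + k) - supConv κ z γ ξ.snd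
        - κ * (‖k‖ ^ 2 - 2 * ⟪ξ.fst - ξ.snd, k⟫) := by
  have h3 := norm_sub_sq_real (ξ.fst - ξ.snd) k
  rw [sub_sub] at h3
  simp only [doubled, WithLp.add_fst, WithLp.add_snd, WithLp.toLp_fst, WithLp.toLp_snd, add_zero,
    h3]
  ring

lemma doubled_add {κ β : ℝ} (x₀ : F) (w z : F → ℝ) (α γ : F → F) (ξ : WithLp 2 (F × F))
    (h k : F) :
    doubled κ β x₀ w z α γ (ξ + WithLp.toLp 2 (h, k)) - doubled κ β x₀ w z α γ ξ
      = (doubled κ β x₀ w z α γ (ξ + WithLp.toLp 2 (h, 0)) - doubled κ β x₀ w z α γ ξ)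
        + (doubled κ β x₀ w z α γ (ξ + WithLp.toLp 2 (0, k)) - doubled κ β x₀ w z α γ ξ)
        + 2 * κ * ⟪h, k⟫ := by
  rw [doubled_fst, doubled_snd]
  have h3 := norm_add_sq_real (ξ.fst - ξ.snd) (h - k)
  have h4 := norm_add_sq_real (ξ.fst - x₀) h
  have h5 := norm_sub_sq_real h k
  rw [← add_sub_add_comm, h5, inner_sub_right] at h3
  rw [← add_sub_right_comm] at h4
  simp only [doubled, WithLp.add_fst, WithLp.add_snd, WithLp.toLp_fst, WithLp.toLp_snd, h3, h4]
  ring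

/-- The operator block `h ↦ (A (h, 0)).fst`. -/
def blockFst (A : WithLp 2 (F × F) →L[ℝ] WithLp 2 (F × F)) : F →L[ℝ] F :=
  WithLp.fstL 2 ℝ F F ∘L A ∘L
    (WithLp.prodContinuousLinearEquiv 2 ℝ F F).symm.toContinuousLinearMap ∘L
      ContinuousLinearMap.inl ℝ F F

/-- The operator block `k ↦ (A (0, k)).snd`. -/
def blockSnd (A : WithLp 2 (F × F) →L[ℝ] WithLp 2 (F × F)) : F →L[ℝ] F :=
  WithLp.sndL 2 ℝ F F ∘L A ∘L
    (WithLp.prodContinuousLinearEquiv 2 ℝ F F).symm.toContinuousLinearMap ∘L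
      ContinuousLinearMap.inr ℝ F F

lemma inner_blockFst (A : WithLp 2 (F × F) →L[ℝ] WithLp 2 (F × F)) (h : F) :
    ⟪A (WithLp.toLp 2 (h, 0)), WithLp.toLp 2 (h, 0)⟫ = ⟪blockFst A h, h⟫ := by
  rw [inner_eq_fst_add_snd]
  simp [blockFst]

lemma inner_blockSnd (A : WithLp 2 (F × F) →L[ℝ] WithLp 2 (F × F)) (h : F) :
    ⟪A (WithLp.toLp 2 (0, h)), WithLp.toLp 2 (0, h)⟫ = ⟪blockSnd A h, h⟫ := by
  rw [inner_eq_fst_add_snd]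
  simp [blockSnd]

lemma norm_sq_toLp {G : Type*} [NormedAddCommGroup G] (h k : G) :
    ‖WithLp.toLp 2 (h, k)‖ ^ 2 = ‖h‖ ^ 2 + ‖k‖ ^ 2 :=
  WithLp.prod_norm_sq_eq_of_L2 _

lemma block_inner_le {κ β : ℝ} {x₀ : F} {w z : F → ℝ} {α γ : F → F} {ξ p : WithLp 2 (F × F)}
    {A : WithLp 2 (F × F) →L[ℝ] WithLp 2 (F × F)}
    (hp : TopAt (doubled κ β x₀ w z α γ) ξ p)
    (hA : ∀ η > (0 : ℝ), ∀ᶠ h in 𝓝 (0 : WithLp 2 (F × F)),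
      |doubled κ β x₀ w z α γ (ξ + h) - doubled κ β x₀ w z α γ ξ - ⟪p, h⟫ - 1 / 2 * ⟪A h, h⟫|
        ≤ η * ‖h‖ ^ 2) (h k : F) :
    1 / 2 * ⟪blockFst A h, h⟫ + 1 / 2 * ⟪blockSnd A k, k⟫ ≤ -(2 * κ * ⟪h, k⟫) := by
  set c := 1 / 2 * ⟪blockFst A h, h⟫ + 1 / 2 * ⟪blockSnd A k, k⟫ + 2 * κ * ⟪h, k⟫ with hc
  suffices hcη : ∀ η > (0 : ℝ), c ≤ η by
    have := le_of_forall_pos_le_add (a := c) (b := 0) fun η hη => by simpa using hcη η hη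
    linarith
  intro η' hη'
  obtain ⟨η, hη, hηle⟩ : ∃ η > (0 : ℝ), η * (‖h‖ ^ 2 + ‖k‖ ^ 2) ≤ η' := by
    refine ⟨η' / (‖h‖ ^ 2 + ‖k‖ ^ 2 + 1), by positivity, ?_⟩
    rw [div_mul_eq_mul_div, div_le_iff₀ (by positivity)]
    nlinarith
  have ht (v : WithLp 2 (F × F)) : Tendsto (fun t : ℝ => t • v) (𝓝[>] 0) (𝓝 0) := by
    have : Continuous fun t : ℝ => t • v := by fun_prop
    simpa using (this.tendsto 0).mono_left nhdsWithin_le_nhds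
  obtain ⟨t, ⟨ht1, ht2⟩, ht0 : 0 < t⟩ := (((ht (WithLp.toLp 2 (h, 0))).eventually (hA η hη)).and
    ((ht (WithLp.toLp 2 (0, k))).eventually (hA η hη))).and self_mem_nhdsWithin |>.exists
  have e1 : t • (WithLp.toLp 2 (h, 0) : WithLp 2 (F × F)) = WithLp.toLp 2 (t • h, 0) := by
    rw [← WithLp.toLp_smul]; simp
  have e2 : t • (WithLp.toLp 2 (0, k) : WithLp 2 (F × F)) = WithLp.toLp 2 (0, t • k) := by
    rw [← WithLp.toLp_smul]; simp
  rw [e1, inner_blockFst, norm_sq_toLp] at ht1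
  rw [e2, inner_blockSnd, norm_sq_toLp] at ht2
  have h3 := hp (ξ + WithLp.toLp 2 (t • h, t • k))
  have h4 := doubled_add (κ := κ) (β := β) x₀ w z α γ ξ (t • h) (t • k)
  have h1 := (abs_le.1 ht1).1
  have h2 := (abs_le.1 ht2).1
  rw [add_sub_cancel_left] at h3
  simp only [inner_eq_fst_add_snd, WithLp.toLp_fst, WithLp.toLp_snd, inner_zero_right, norm_zero,
    map_smul, real_inner_smul_left, real_inner_smul_right, norm_smul, Real.norm_of_nonneg ht0.le]
    at h1 h2 h3 h4
  have h5 : t ^ 2 * c ≤ t ^ 2 * (η * (‖h‖ ^ 2 + ‖k‖ ^ 2)) := by rw [hc]; nlinarith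
  exact (le_of_mul_le_mul_left h5 (by positivity)).trans hηle

lemma isLocalMax_of_eventually {w : F → ℝ} {a P : F} {X : F →L[ℝ] F}
    (h : ∀ᶠ e in 𝓝 (0 : F), w (a + e) ≤ w a + ⟪P, e⟫ + 1 / 2 * ⟪X e, e⟫) :
    IsLocalMax (fun y => w y - quadTest a P X y) a := by
  have ht : Tendsto (fun y => y - a) (𝓝 a) (𝓝 0) := by
    have : Continuous fun y => y - a := by fun_prop
    simpa using this.tendsto a
  filter_upwards [ht.eventually h] with y hy
  simp only [quadTest, add_sub_cancel, sub_self, inner_zero_right] at hy ⊢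
  linarith

/-- A quantitative form of the Crandall-Ishii maximum principle for semicontinuous functions. -/
theorem exists_quadTest_pair [FiniteDimensional ℝ F] {κ β τ B B' : ℝ} (hκ : 0 < κ) (hβ : 0 < β)
    (hτ : 0 < τ) (x₀ : F) {w z : F → ℝ}
    (hw : UpperSemicontinuous w) (hB : ∀ x, |w x| ≤ B)
    (hz : UpperSemicontinuous z) (hB' : ∀ x, |z x| ≤ B') :
    ∃ (x y a b P R : F) (X Y : F →L[ℝ] F),
      w x₀ + z x₀ - τ ≤ w a + z b - κ / 2 * (‖x - a‖ ^ 2 + ‖y - b‖ ^ 2 + ‖x - y‖ ^ 2)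
        - β / 2 * ‖x - x₀‖ ^ 2 ∧
      ‖P + R‖ ≤ 2 * β * ‖x - x₀‖ + 2 * τ ∧ ‖R‖ ≤ 2 * κ * ‖x - y‖ + τ ∧
      (∀ h k, 1 / 2 * ⟪X h, h⟫ + 1 / 2 * ⟪Y k, k⟫
        ≤ κ * ‖h - k‖ ^ 2 + (β + τ) * ‖h‖ ^ 2 + τ * ‖k‖ ^ 2) ∧
      IsLocalMax (fun y => w y - quadTest a P X y) a ∧
      IsLocalMax (fun y => z y - quadTest b R Y y) b := by
  obtain ⟨δ, hδ, hδτ', hδτ⟩ : ∃ δ > 0, δ ≤ τ ∧ 2 * δ ^ 2 / β + δ ^ 2 / (2 * κ) ≤ τ := by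
    have h : Tendsto (fun δ : ℝ => 2 * δ ^ 2 / β + δ ^ 2 / (2 * κ)) (𝓝[>] 0) (𝓝 0) := by
      have : Continuous fun δ : ℝ => 2 * δ ^ 2 / β + δ ^ 2 / (2 * κ) := by fun_prop
      simpa using (this.tendsto 0).mono_left nhdsWithin_le_nhds
    obtain ⟨δ, ⟨h1, h2⟩, h3⟩ := ((h.eventually (ge_mem_nhds hτ)).and (nhdsWithin_le_nhds
      (ge_mem_nhds hτ))).and self_mem_nhdsWithin |>.exists
    exact ⟨δ, h3, h2, h1⟩
  obtain ⟨α, hα⟩ := exists_isMaximizer hκ hw hB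
  obtain ⟨γ, hγ⟩ := exists_isMaximizer hκ hz hB'
  obtain ⟨p, ξ, A, hp, htop, hA⟩ := exists_taylor_at_perturbed_max (by positivity : 0 < 3 * κ + β)
    hδ (doubled_subgradAt hκ hβ (x₀ := x₀) hα hγ) (doubled_topAt hκ hβ hδτ hα hγ hw hB hz hB')
  have hp1 : ‖p.fst‖ ≤ δ := (WithLp.norm_fst_le _ _).trans hp.le
  have hp2 : ‖p.snd‖ ≤ δ := (WithLp.norm_snd_le _ _).trans hp.le
  refine ⟨ξ.fst, ξ.snd, α ξ.fst, γ ξ.snd,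
    p.fst + (2 * κ) • (ξ.fst - ξ.snd) + (2 * β) • (ξ.fst - x₀),
    p.snd - (2 * κ) • (ξ.fst - ξ.snd),
    blockFst A + (2 * (κ + β + τ)) • ContinuousLinearMap.id ℝ F,
    blockSnd A + (2 * (κ + τ)) • ContinuousLinearMap.id ℝ F, ?_, ?_, ?_, fun h k => ?_, ?_, ?_⟩
  · have h1 := htop (WithLp.toLp 2 (x₀, x₀))
    have h2 := hα x₀ x₀
    have h3 := hγ x₀ x₀
    have h4 := le_doublingPenalty hκ hβ hδτ hp1 hp2 x₀ ξ.fst ξ.snd (α ξ.fst) (γ ξ.snd)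
    rw [inner_eq_fst_add_snd] at h1
    simp only [doublingPenalty, doubled, WithLp.sub_fst, WithLp.sub_snd, WithLp.toLp_fst,
      WithLp.toLp_snd, inner_sub_right, sub_self, norm_zero] at h1 h2 h3 h4
    have e1 : supConv κ w α ξ.fst = w (α ξ.fst) - κ * ‖ξ.fst - α ξ.fst‖ ^ 2 := rfl
    have e2 : supConv κ z γ ξ.snd = z (γ ξ.snd) - κ * ‖ξ.snd - γ ξ.snd‖ ^ 2 := rfl
    linarith
  · have e : p.fst + (2 * κ) • (ξ.fst - ξ.snd) + (2 * β) • (ξ.fst - x₀)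
        + (p.snd - (2 * κ) • (ξ.fst - ξ.snd)) = (2 * β) • (ξ.fst - x₀) + (p.fst + p.snd) := by abel
    rw [e]
    refine (norm_add_le _ _).trans (add_le_add ?_ ((norm_add_le _ _).trans (by linarith)))
    rw [norm_smul, Real.norm_of_nonneg (by positivity)]
  · refine (norm_sub_le _ _).trans ?_
    rw [norm_smul, Real.norm_of_nonneg (by positivity)]
    linarith
  · have h1 := block_inner_le htop hA h k
    have h2 := norm_sub_sq_real h k
    simp only [_root_.add_apply, _root_.smul_apply,
      ContinuousLinearMap.id_apply, inner_add_left, real_inner_smul_left,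
      real_inner_self_eq_norm_sq, h2]
    linarith
  · refine isLocalMax_of_eventually ?_
    have ht : Tendsto (fun e : F => (WithLp.toLp 2 (e, 0) : WithLp 2 (F × F))) (𝓝 0) (𝓝 0) := by
      have : Continuous fun e : F => (WithLp.toLp 2 (e, 0) : WithLp 2 (F × F)) := by fun_prop
      exact this.tendsto 0
    filter_upwards [ht.eventually (hA τ hτ)] with e he
    have h1 := (abs_le.1 he).2
    have h2 := hα.le_supConv_add' ξ.fst e
    have e1 : supConv κ w α ξ.fst = w (α ξ.fst) - κ * ‖ξ.fst - α ξ.fst‖ ^ 2 := rfl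
    rw [doubled_fst, inner_blockFst, norm_sq_toLp, inner_eq_fst_add_snd] at h1
    simp only [WithLp.toLp_fst, WithLp.toLp_snd, inner_zero_right, norm_zero, inner_sub_left]
      at h1
    simp only [_root_.add_apply, _root_.smul_apply,
      ContinuousLinearMap.id_apply, inner_add_left, inner_sub_left, real_inner_smul_left,
      real_inner_self_eq_norm_sq]
    linarith
  · refine isLocalMax_of_eventually ?_
    have ht : Tendsto (fun e : F => (WithLp.toLp 2 (0, e) : WithLp 2 (F × F))) (𝓝 0) (𝓝 0) := by
      have : Continuous fun e : F => (WithLp.toLp 2 (0, e) : WithLp 2 (F × F)) := by fun_prop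
      exact this.tendsto 0
    filter_upwards [ht.eventually (hA τ hτ)] with e he
    have h1 := (abs_le.1 he).2
    have h2 := hγ.le_supConv_add' ξ.snd e
    have e1 : supConv κ z γ ξ.snd = z (γ ξ.snd) - κ * ‖ξ.snd - γ ξ.snd‖ ^ 2 := rfl
    rw [doubled_snd, inner_blockSnd, norm_sq_toLp, inner_eq_fst_add_snd] at h1
    simp only [WithLp.toLp_fst, WithLp.toLp_snd, inner_zero_right, norm_zero, inner_sub_left]
      at h1
    simp only [_root_.add_apply, _root_.smul_apply,
      ContinuousLinearMap.id_apply, inner_add_left, inner_sub_left, real_inner_smul_left,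
      real_inner_self_eq_norm_sq]
    linarith

end Ishii

section QuadCalculus

/-- The symmetric part of `X`. -/
def symPart (X : E d →L[ℝ] E d) : E d →L[ℝ] E d :=
  (1 / 2 : ℝ) • (X + ContinuousLinearMap.adjoint X)

lemma inner_symPart (X : E d →L[ℝ] E d) (v : E d) : ⟪symPart X v, v⟫ = ⟪X v, v⟫ := by
  simp only [symPart, _root_.smul_apply, _root_.add_apply, real_inner_smul_left, inner_add_left,
    ContinuousLinearMap.adjoint_inner_left]
  rw [real_inner_comm]; ring

lemma hasFDerivAt_quadTest (a P : E d) (X : E d →L[ℝ] E d) (y : E d) :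
    HasFDerivAt (quadTest a P X) (innerSL ℝ (P + symPart X (y - a))) y := by
  have h0 : HasFDerivAt (fun y => y - a) (ContinuousLinearMap.id ℝ (E d)) y :=
    (hasFDerivAt_id y).sub_const a
  have h1 := ((hasFDerivAt_const P y).inner ℝ h0).add
    ((((X.hasFDerivAt).comp y h0).inner ℝ h0).const_mul (1 / 2 : ℝ))
  refine h1.congr_fderiv ?_
  ext v
  simp [fderivInnerCLM_apply, symPart, inner_sub_left, inner_sub_right,
    ContinuousLinearMap.adjoint_inner_left, real_inner_comm]
  ring

lemma contDiff_quadTest (a P : E d) (X : E d →L[ℝ] E d) : ContDiff ℝ 2 (quadTest a P X) := by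
  unfold quadTest
  have h : ContDiff ℝ 2 fun y : E d => y - a := contDiff_id.sub contDiff_const
  exact (contDiff_const.inner ℝ h).add (contDiff_const.mul ((X.contDiff.comp h).inner ℝ h))

lemma gradient_quadTest (a P : E d) (X : E d →L[ℝ] E d) : gradient (quadTest a P X) a = P := by
  refine HasGradientAt.gradient (hasGradientAt_iff_hasFDerivAt.2 ?_)
  exact (hasFDerivAt_quadTest a P X a).congr_fderiv (by ext v; simp)

lemma hess_apply (φ : E d → ℝ) (x : E d) (i j : Fin d) : hess φ x i j =
    fderiv ℝ (fderiv ℝ φ) x (EuclideanSpace.single i 1) (EuclideanSpace.single j 1) := by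
  simp [hess, iteratedFDeriv_two_apply]

lemma hasFDerivAt_fderiv_quadTest (a P : E d) (X : E d →L[ℝ] E d) (y : E d) :
    HasFDerivAt (fderiv ℝ (quadTest a P X)) (innerSL ℝ ∘L symPart X) y := by
  have h : fderiv ℝ (quadTest a P X) = fun y => innerSL ℝ (P + symPart X (y - a)) :=
    funext fun y => (hasFDerivAt_quadTest a P X y).fderiv
  rw [h]
  have h0 : HasFDerivAt (fun y => y - a) (ContinuousLinearMap.id ℝ (E d)) y :=
    (hasFDerivAt_id y).sub_const a
  exact (innerSL ℝ).hasFDerivAt.comp y (((symPart X).hasFDerivAt.comp y h0).const_add P)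

lemma hess_quadTest (a P : E d) (X : E d →L[ℝ] E d) (i j : Fin d) :
    hess (quadTest a P X) a i j =
      ⟪symPart X (EuclideanSpace.single i 1), EuclideanSpace.single j 1⟫ := by
  rw [hess_apply, (hasFDerivAt_fderiv_quadTest a P X a).fderiv]
  rfl

/-- The `l`-th column of a matrix as a Euclidean vector. -/
def colVec (A : Matrix (Fin d) (Fin d') ℝ) (l : Fin d') : E d := WithLp.toLp 2 fun k => A k l

lemma colVec_eq_sum (A : Matrix (Fin d) (Fin d') ℝ) (l : Fin d') :
    colVec A l = ∑ k, A k l • EuclideanSpace.single k (1 : ℝ) := by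
  ext i
  simp [colVec, Pi.single_apply]

lemma sum_norm_colVec_sq (A : Matrix (Fin d) (Fin d') ℝ) :
    ∑ l, ‖colVec A l‖ ^ 2 = frobNorm A ^ 2 := by
  rw [frobNorm, Real.sq_sqrt (by positivity), Finset.sum_comm]
  simp [colVec, EuclideanSpace.norm_sq_eq]

lemma trace_half_mul (A : Matrix (Fin d) (Fin d') ℝ) (X : Matrix (Fin d) (Fin d) ℝ) :
    Matrix.trace (((1 : ℝ) / 2) • (A * Aᵀ) * X)
      = 1 / 2 * ∑ i, ∑ j, ∑ l, A i l * A j l * X j i := by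
  rw [Matrix.smul_mul, Matrix.trace_smul, smul_eq_mul]
  simp only [Matrix.trace, Matrix.diag, Matrix.mul_apply, Matrix.transpose_apply, Finset.sum_mul]

lemma trace_hess_quadTest (A : Matrix (Fin d) (Fin d') ℝ) (a P : E d) (X : E d →L[ℝ] E d) :
    Matrix.trace (((1 : ℝ) / 2) • (A * Aᵀ) * hess (quadTest a P X) a)
      = 1 / 2 * ∑ l, ⟪X (colVec A l), colVec A l⟫ := by
  rw [trace_half_mul]
  congr 1
  have h (l : Fin d') : ⟪X (colVec A l), colVec A l⟫
      = ∑ i, ∑ j, A i l * A j l * hess (quadTest a P X) a j i := by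
    rw [← inner_symPart, colVec_eq_sum, map_sum, sum_inner, Finset.sum_comm]
    simp only [inner_sum, map_smul, real_inner_smul_left, real_inner_smul_right, hess_quadTest]
    exact Finset.sum_congr rfl fun i _ => Finset.sum_congr rfl fun j _ => by ring
  simp only [h]
  rw [Finset.sum_comm]
  conv_rhs => rw [Finset.sum_comm]
  rw [Finset.sum_comm]
  refine Finset.sum_congr rfl fun i _ => ?_
  rw [Finset.sum_comm]

/-- Viscosity subsolution property tested only with quadratic polynomials. -/
def QuadSub (F : Op d M) (u : Fin M → E d → ℝ) : Prop :=
  ∀ (i : Fin M) (x p : E d) (X : E d →L[ℝ] E d),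
    IsLocalMax (fun y => u i y - quadTest x p X y) x →
      F i x u p (hess (quadTest x p X) x) ≤ 0

/-- Viscosity supersolution property tested only with quadratic polynomials. -/
def QuadSuper (F : Op d M) (u : Fin M → E d → ℝ) : Prop :=
  ∀ (i : Fin M) (x p : E d) (X : E d →L[ℝ] E d),
    IsLocalMin (fun y => u i y - quadTest x p X y) x →
      0 ≤ F i x u p (hess (quadTest x p X) x)

lemma IsSubsolution.quadSub {F : Op d M} {u : Fin M → E d → ℝ} (h : IsSubsolution F u) :
    QuadSub F u := fun i x p X hx => by
  simpa only [gradient_quadTest] using h.2 i _ (contDiff_quadTest x p X) x hx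

lemma IsSupersolution.quadSuper {F : Op d M} {u : Fin M → E d → ℝ} (h : IsSupersolution F u) :
    QuadSuper F u := fun i x p X hx => by
  simpa only [gradient_quadTest] using h.2 i _ (contDiff_quadTest x p X) x hx

lemma continuous_hess {φ : E d → ℝ} (hφ : ContDiff ℝ 2 φ) (i j : Fin d) :
    Continuous fun x => hess φ x i j := by
  have h := hφ.continuous_iteratedFDeriv (m := 2) le_rfl
  exact (ContinuousMultilinearMap.apply ℝ (fun _ : Fin 2 => E d) ℝ
    ![EuclideanSpace.single i (1 : ℝ), EuclideanSpace.single j (1 : ℝ)]).continuous.comp h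

lemma continuous_gradient {φ : E d → ℝ} (hφ : ContDiff ℝ 2 φ) : Continuous (gradient φ) :=
  (InnerProductSpace.toDual ℝ (E d)).symm.continuous.comp
    (hφ.continuous_fderiv two_ne_zero)

/-- Adding a quartic makes a local maximum strict without changing the second-order jet. -/
lemma exists_quartic_perturbation {φ : E d → ℝ} (hφ : ContDiff ℝ 2 φ) (x : E d) (c : ℝ) :
    ∃ ψ : E d → ℝ, ContDiff ℝ 2 ψ ∧ gradient ψ x = gradient φ x ∧ hess ψ x = hess φ x ∧
      ∀ y, ψ y = φ y + c * ‖y - x‖ ^ 4 := by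
  set q : E d → ℝ := quadTest x 0 ((2 : ℝ) • ContinuousLinearMap.id ℝ (E d)) with hqdef
  have hq : ∀ y, q y = ‖y - x‖ ^ 2 := fun y => by
    simp only [hqdef, quadTest, inner_zero_left, _root_.smul_apply, ContinuousLinearMap.id_apply,
      real_inner_smul_left, real_inner_self_eq_norm_sq]
    ring
  have hqx : q x = 0 := by simp [hq]
  have hqc : ContDiff ℝ 2 q := contDiff_quadTest _ _ _
  have hqd : ∀ y, HasFDerivAt q (fderiv ℝ q y) y := fun y =>
    (hqc.differentiable (by norm_num) y).hasFDerivAt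
  have hq0 : fderiv ℝ q x = 0 := by
    rw [hqdef, (hasFDerivAt_quadTest _ _ _ _).fderiv]; simp
  have h1 : ∀ y, HasFDerivAt (fun y => c * q y ^ 2) ((2 * c * q y) • fderiv ℝ q y) y := fun y =>
    (((hqd y).pow 2).const_mul c).congr_fderiv (by ext v; simp; ring)
  have hφd : ∀ y, HasFDerivAt φ (fderiv ℝ φ y) y := fun y =>
    (hφ.differentiable (by norm_num) y).hasFDerivAt
  have h2 : fderiv ℝ (fun y => φ y + c * q y ^ 2)
      = fun y => fderiv ℝ φ y + (2 * c * q y) • fderiv ℝ q y :=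
    funext fun y => ((hφd y).add (h1 y)).fderiv
  have hφ' : HasFDerivAt (fderiv ℝ φ) (fderiv ℝ (fderiv ℝ φ) x) x :=
    ((hφ.fderiv_right (m := 1) (by norm_num)).differentiable (by norm_num) x).hasFDerivAt
  have hq' : HasFDerivAt (fderiv ℝ q) (fderiv ℝ (fderiv ℝ q) x) x :=
    ((hqc.fderiv_right (m := 1) (by norm_num)).differentiable (by norm_num) x).hasFDerivAt
  have h3 : fderiv ℝ (fderiv ℝ (fun y => φ y + c * q y ^ 2)) x = fderiv ℝ (fderiv ℝ φ) x := by
    rw [h2]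
    refine (HasFDerivAt.congr_fderiv (hφ'.add (((hqd x).const_mul (2 * c)).smul hq')) ?_).fderiv
    ext v w
    simp [hqx, hq0]
  refine ⟨fun y => φ y + c * q y ^ 2, hφ.add (contDiff_const.mul (hqc.pow 2)), ?_, ?_, fun y => ?_⟩
  · simp [gradient, h2, hqx]
  · ext i j
    rw [hess_apply, hess_apply, h3]
  · simp only [hq]; ring

end QuadCalculus

section Operators

lemma frobNorm_nonneg (A : Matrix (Fin d) (Fin d') ℝ) : 0 ≤ frobNorm A := Real.sqrt_nonneg _

lemma abs_entry_le_frobNorm (A : Matrix (Fin d) (Fin d') ℝ) (i : Fin d) (l : Fin d') :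
    |A i l| ≤ frobNorm A := by
  refine Real.abs_le_sqrt ?_
  calc A i l ^ 2 ≤ ∑ l, A i l ^ 2 :=
        Finset.single_le_sum (f := fun l => A i l ^ 2) (fun _ _ => sq_nonneg _) (Finset.mem_univ l)
    _ ≤ ∑ k, ∑ l, A k l ^ 2 :=
        Finset.single_le_sum (f := fun k => ∑ l, A k l ^ 2)
          (fun _ _ => Finset.sum_nonneg fun _ _ => sq_nonneg _) (Finset.mem_univ i)

lemma abs_mul_sub_mul_le {a b a' b' C D : ℝ} (ha : |a| ≤ C) (hb' : |b'| ≤ C)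
    (haa : |a - a'| ≤ D) (hbb : |b - b'| ≤ D) : |a * b - a' * b'| ≤ 2 * C * D := by
  have e : a * b - a' * b' = a * (b - b') + (a - a') * b' := by ring
  have hC := (abs_nonneg _).trans ha
  have hD := (abs_nonneg _).trans haa
  rw [e]
  refine (abs_add_le _ _).trans ?_
  rw [abs_mul, abs_mul]
  nlinarith [mul_le_mul ha hbb (abs_nonneg _) hC, mul_le_mul haa hb' (abs_nonneg _) hD]

lemma abs_trace_sub_le {A A' : Matrix (Fin d) (Fin d') ℝ} {C D e : ℝ} (hA : frobNorm A ≤ C)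
    (hA' : frobNorm A' ≤ C) (hD : frobNorm (A - A') ≤ D) (X X' : Matrix (Fin d) (Fin d) ℝ)
    (hX : ∀ i j, |X i j - X' i j| ≤ e) :
    |Matrix.trace (((1 : ℝ) / 2) • (A * Aᵀ) * X) - Matrix.trace (((1 : ℝ) / 2) • (A' * A'ᵀ) * X')|
      ≤ 1 / 2 * ∑ i : Fin d, ∑ j : Fin d, ∑ _l : Fin d', (C ^ 2 * e + 2 * C * D * |X' j i|) := by
  have hC := (frobNorm_nonneg _).trans hA
  rw [trace_half_mul, trace_half_mul, ← mul_sub, abs_mul, abs_of_pos (by norm_num : (0:ℝ) < 1 / 2)]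
  refine mul_le_mul_of_nonneg_left ?_ (by norm_num)
  simp only [← Finset.sum_sub_distrib]
  refine (Finset.abs_sum_le_sum_abs _ _).trans (Finset.sum_le_sum fun i _ => ?_)
  refine (Finset.abs_sum_le_sum_abs _ _).trans (Finset.sum_le_sum fun j _ => ?_)
  refine (Finset.abs_sum_le_sum_abs _ _).trans (Finset.sum_le_sum fun l _ => ?_)
  have e1 : A i l * A j l * X j i - A' i l * A' j l * X' j i
      = A i l * A j l * (X j i - X' j i) + (A i l * A j l - A' i l * A' j l) * X' j i := by ring
  have b := fun k => (abs_entry_le_frobNorm A k l).trans hA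
  have b' := fun k => (abs_entry_le_frobNorm A' k l).trans hA'
  have bd : ∀ k, |A k l - A' k l| ≤ D := fun k => (abs_entry_le_frobNorm (A - A') k l).trans hD
  rw [e1]
  refine (abs_add_le _ _).trans (add_le_add ?_ ?_)
  · rw [abs_mul, abs_mul, sq]
    exact mul_le_mul (mul_le_mul (b i) (b j) (abs_nonneg _) hC) (hX j i) (abs_nonneg _)
      (mul_nonneg hC hC)
  · rw [abs_mul]
    exact mul_le_mul_of_nonneg_right (abs_mul_sub_mul_le (b i) (b' j) (bd i) (bd j))
      (abs_nonneg _)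

/-- The derivative part of `L^α_i`. -/
def HJBData.dpart (P : HJBData d d' M 𝒜) (i : Fin M) (α : 𝒜) (x p : E d)
    (X : Matrix (Fin d) (Fin d) ℝ) : ℝ :=
  - Matrix.trace (((1 : ℝ) / 2) • (P.σm i α x * (P.σm i α x)ᵀ) * X) - ⟪P.bv i α x, p⟫

/-- The zeroth-order part of `L^α_i`. -/
def HJBData.zpart (P : HJBData d d' M 𝒜) (i : Fin M) (α : 𝒜) (x : E d) (s : Fin M → ℝ) : ℝ :=
  P.cz i α x * s i - P.runCost i α x - ∑ j ∈ Finset.univ.erase i, P.dcp i j α x * s j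

lemma HJBData.L_eq (P : HJBData d d' M 𝒜) (i : Fin M) (α : 𝒜) (x : E d)
    (s : Fin M → ℝ) (p : E d) (X : Matrix (Fin d) (Fin d) ℝ) :
    P.L i α x s p X = P.dpart i α x p X + P.zpart i α x s := by
  rw [HJBData.L, HJBData.dpart, HJBData.zpart]; ring

variable {P : HJBData d d' M 𝒜} {Q : ImpulseData d M 𝒵} {C lam0 κ₀ : ℝ}

lemma H1.nonneg (h1 : H1 P C lam0) (i : Fin M) : 0 ≤ C := by
  obtain ⟨α, hα⟩ := (h1.2.1 i).1
  obtain ⟨-, -, -, -, -, -, -, -, -, hc, -⟩ := h1.2.2 i α hα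
  exact (abs_nonneg _).trans (hc 0)

lemma H1.zpart_le (h1 : H1 P C lam0) {i : Fin M} {α : 𝒜} (hα : α ∈ P.A i) {B e : ℝ} {x y : E d}
    {s t : Fin M → ℝ} (hxy : ‖x - y‖ ≤ e) (hs : ∀ j, |s j| ≤ B) (ht : ∀ j, |t j| ≤ B)
    (hi : s i ≤ t i + e) (hj : ∀ j, j ≠ i → t j ≤ s j + e) :
    P.zpart i α x s ≤ P.zpart i α y t + (C * B + 2 * C + M * (C * B + C)) * e := by
  have hC := h1.nonneg i
  obtain ⟨-, -, -, -, -, -, -, -, -, hc, hcl, -, hl, hd, hd0, hlam⟩ := h1.2.2 i α hα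
  have he : 0 ≤ e := (norm_nonneg _).trans hxy
  have hB : 0 ≤ B := (abs_nonneg _).trans (hs i)
  have lip {r : ℝ} (h : r ≤ C * ‖x - y‖) : r ≤ C * e := h.trans (mul_le_mul_of_nonneg_left hxy hC)
  have hcy : 0 ≤ P.cz i α y := by
    have := Finset.sum_nonneg fun j hj => hd0 j hj y
    linarith [hlam y, h1.1]
  have k1 : P.cz i α x * s i ≤ P.cz i α y * t i + (C * B + C) * e := by
    have a1 : |(P.cz i α x - P.cz i α y) * s i| ≤ C * e * B := by
      rw [abs_mul]
      exact mul_le_mul (lip (hcl x y)) (hs i) (abs_nonneg _) (mul_nonneg hC he)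
    have a2 := mul_le_mul_of_nonneg_left hi hcy
    have a3 := mul_le_mul_of_nonneg_right ((le_abs_self _).trans (hc y)) he
    have := (abs_le.1 a1).2
    nlinarith
  have k2 := (abs_le.1 (lip (hl x y))).1
  have k3 : ∑ j ∈ Finset.univ.erase i, P.dcp i j α y * t j
      ≤ ∑ j ∈ Finset.univ.erase i, P.dcp i j α x * s j + M * (C * B + C) * e := by
    have a0 : ∑ _j ∈ Finset.univ.erase i, (C * B + C) * e ≤ M * (C * B + C) * e := by
      rw [Finset.sum_const, nsmul_eq_mul, mul_assoc]
      refine mul_le_mul_of_nonneg_right ?_ (by positivity)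
      exact_mod_cast (Finset.card_erase_le).trans (by simp)
    refine le_trans ?_ (add_le_add_right a0 _)
    rw [← Finset.sum_add_distrib]
    refine Finset.sum_le_sum fun j hjm => ?_
    have a1 : |(P.dcp i j α x - P.dcp i j α y) * t j| ≤ C * e * B := by
      rw [abs_mul]
      exact mul_le_mul (lip ((hd j).2 x y)) (ht j) (abs_nonneg _) (mul_nonneg hC he)
    have a2 := mul_le_mul_of_nonneg_left (hj j (Finset.ne_of_mem_erase hjm)) (hd0 j hjm x)
    have a3 := mul_le_mul_of_nonneg_right ((le_abs_self _).trans ((hd j).1 x)) he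
    have := (abs_le.1 a1).1
    nlinarith
  rw [HJBData.zpart, HJBData.zpart]
  linarith

lemma H1.abs_dpart_sub_le (h1 : H1 P C lam0) {i : Fin M} {α : 𝒜} (hα : α ∈ P.A i) {e : ℝ}
    {x y p q : E d} {X Y : Matrix (Fin d) (Fin d) ℝ} (hxy : ‖x - y‖ ≤ e) (hpq : ‖p - q‖ ≤ e)
    (hXY : ∀ i j, |X i j - Y i j| ≤ e) :
    |P.dpart i α x p X - P.dpart i α y q Y| ≤
      (1 / 2 * ∑ i : Fin d, ∑ j : Fin d, ∑ _l : Fin d', (C ^ 2 + 2 * C * C * |Y j i|)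
        + (C + C * ‖q‖)) * e := by
  have hC := h1.nonneg i
  obtain ⟨-, -, -, -, -, hσ, hσl, hb, hbl, -⟩ := h1.2.2 i α hα
  have he : 0 ≤ e := (norm_nonneg _).trans hxy
  have lip {r : ℝ} (h : r ≤ C * ‖x - y‖) : r ≤ C * e := h.trans (mul_le_mul_of_nonneg_left hxy hC)
  have k1 := abs_trace_sub_le (hσ x) (hσ y) (lip (hσl x y)) X Y hXY
  have k2 : |⟪P.bv i α x, p⟫ - ⟪P.bv i α y, q⟫| ≤ (C + C * ‖q‖) * e := by
    have e1 : ⟪P.bv i α x, p⟫ - ⟪P.bv i α y, q⟫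
        = ⟪P.bv i α x, p - q⟫ + ⟪P.bv i α x - P.bv i α y, q⟫ := by
      rw [inner_sub_right, inner_sub_left]; ring
    rw [e1]
    refine (abs_add_le _ _).trans ?_
    have a1 := (abs_real_inner_le_norm (P.bv i α x) (p - q)).trans
      (mul_le_mul (hb x) hpq (norm_nonneg _) hC)
    have a2 := (abs_real_inner_le_norm (P.bv i α x - P.bv i α y) q).trans
      (mul_le_mul_of_nonneg_right (lip (hbl x y)) (norm_nonneg _))
    linarith
  have e2 : (1 / 2 * ∑ i : Fin d, ∑ j : Fin d, ∑ _l : Fin d', (C ^ 2 + 2 * C * C * |Y j i|)) * e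
      = 1 / 2 * ∑ i : Fin d, ∑ j : Fin d, ∑ _l : Fin d',
          (C ^ 2 * e + 2 * C * (C * e) * |Y j i|) := by
    rw [mul_assoc]
    simp only [Finset.sum_mul]
    congr 1
    refine Finset.sum_congr rfl fun _ _ => Finset.sum_congr rfl fun _ _ =>
      Finset.sum_congr rfl fun _ _ => by ring
  rw [add_mul, e2, HJBData.dpart, HJBData.dpart]
  rw [abs_le] at k1 k2 ⊢
  constructor <;> linarith

lemma H1.bddAbove_L (h1 : H1 P C lam0) (i : Fin M) (x : E d) (s : Fin M → ℝ) (p : E d)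
    (X : Matrix (Fin d) (Fin d) ℝ) : BddAbove ((fun α => P.L i α x s p X) '' P.A i) := by
  obtain ⟨e, he⟩ : ∃ e : ℝ, ∀ i j, |X i j| ≤ e := by
    refine ⟨∑ i, ∑ j, |X i j|, fun i j => ?_⟩
    calc |X i j| ≤ ∑ j, |X i j| :=
          Finset.single_le_sum (f := fun j => |X i j|) (fun _ _ => abs_nonneg _) (Finset.mem_univ j)
      _ ≤ _ := Finset.single_le_sum (f := fun i => ∑ j, |X i j|)
          (fun _ _ => Finset.sum_nonneg fun _ _ => abs_nonneg _) (Finset.mem_univ i)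
  set e' := max e (max ‖p‖ 0)
  refine ⟨(1 / 2 * ∑ i : Fin d, ∑ j : Fin d, ∑ _l : Fin d', (C ^ 2 + 2 * C * C * |(0 : ℝ)|)
        + (C + C * ‖(0 : E d)‖)) * e' + (C * |s i| + C + ∑ j ∈ Finset.univ.erase i, C * |s j|), ?_⟩
  rintro _ ⟨α, hα, rfl⟩
  have k := h1.abs_dpart_sub_le hα (x := x) (y := x) (p := p) (q := 0) (X := X) (Y := 0) (e := e')
    (by simp [e']) (by simp [e']) (fun i j => by
      rw [Matrix.zero_apply, sub_zero]; exact (he i j).trans (le_max_left _ _))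
  have k0 : P.dpart i α x 0 0 = 0 := by simp [HJBData.dpart]
  rw [k0, sub_zero] at k
  have k' := (abs_le.1 k).2
  obtain ⟨-, -, -, -, -, -, -, -, -, hc, -, hl, -, hd, -⟩ := h1.2.2 i α hα
  have a {r t : ℝ} (h : |r| ≤ C) : |r * t| ≤ C * |t| := by
    rw [abs_mul]; exact mul_le_mul_of_nonneg_right h (abs_nonneg _)
  have k2 := (abs_le.1 (a (t := s i) (hc x))).2
  have k3 := (abs_le.1 (hl x)).1
  have k4 : -∑ j ∈ Finset.univ.erase i, C * |s j|
      ≤ ∑ j ∈ Finset.univ.erase i, P.dcp i j α x * s j := by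
    rw [← Finset.sum_neg_distrib]
    exact Finset.sum_le_sum fun j _ => (abs_le.1 (a ((hd j).1 x))).1
  simp only [HJBData.L_eq, HJBData.zpart]
  simp only [Matrix.zero_apply] at k'
  linarith

lemma H1.le_Ham (h1 : H1 P C lam0) {i : Fin M} {α : 𝒜} (hα : α ∈ P.A i) (x : E d)
    (s : Fin M → ℝ) (p : E d) (X : Matrix (Fin d) (Fin d) ℝ) :
    P.L i α x s p X ≤ P.Ham i x s p X :=
  le_csSup (h1.bddAbove_L i x s p X) ⟨α, hα, rfl⟩

lemma H1.Ham_le (h1 : H1 P C lam0) {i : Fin M} {x : E d} {s : Fin M → ℝ} {p : E d}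
    {X : Matrix (Fin d) (Fin d) ℝ} {c : ℝ} (h : ∀ α ∈ P.A i, P.L i α x s p X ≤ c) :
    P.Ham i x s p X ≤ c :=
  csSup_le ((h1.2.1 i).1.image _) (by rintro _ ⟨α, hα, rfl⟩; exact h α hα)

/-- Upper and lower estimates for the Hamiltonian near a fixed point, with error linear in the
perturbation size. -/
lemma H1.exists_Ham_le (h1 : H1 P C lam0) (i : Fin M) (B : ℝ) (q : E d)
    (Y : Matrix (Fin d) (Fin d) ℝ) : ∃ K : ℝ, ∀ (e : ℝ) (x y p : E d)
      (X : Matrix (Fin d) (Fin d) ℝ) (s t : Fin M → ℝ), ‖x - y‖ ≤ e → ‖p - q‖ ≤ e →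
      (∀ i j, |X i j - Y i j| ≤ e) → (∀ j, |s j| ≤ B) → (∀ j, |t j| ≤ B) →
      (s i ≤ t i + e → (∀ j, j ≠ i → t j ≤ s j + e) →
        P.Ham i x s p X ≤ P.Ham i y t q Y + K * e) ∧
      (t i ≤ s i + e → (∀ j, j ≠ i → s j ≤ t j + e) →
        P.Ham i y t q Y ≤ P.Ham i x s p X + K * e) := by
  refine ⟨(1 / 2 * ∑ i : Fin d, ∑ j : Fin d, ∑ _l : Fin d', (C ^ 2 + 2 * C * C * |Y j i|)
        + (C + C * ‖q‖)) + (C * B + 2 * C + M * (C * B + C)),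
    fun e x y p X s t hxy hpq hXY hs ht => ⟨fun hi hj => h1.Ham_le fun α hα => ?_,
      fun hi hj => h1.Ham_le fun α hα => ?_⟩⟩
  · have a1 := h1.le_Ham hα y t q Y
    have a2 := (abs_le.1 (h1.abs_dpart_sub_le hα hxy hpq hXY)).2
    have a3 := h1.zpart_le hα hxy hs ht hi hj
    rw [HJBData.L_eq] at a1 ⊢
    linarith
  · have a1 := h1.le_Ham hα x s p X
    have a2 := (abs_le.1 (h1.abs_dpart_sub_le hα hxy hpq hXY)).1
    have a3 := h1.zpart_le hα ((norm_sub_rev y x).trans_le hxy) ht hs hi hj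
    rw [HJBData.L_eq] at a1 ⊢
    linarith

lemma H2.bddBelow (h2 : H2 Q κ₀) {u : Fin M → E d → ℝ} {B : ℝ} {i : Fin M}
    (hu : ∀ x, -B ≤ u i x) (x : E d) :
    BddBelow ((fun z => u i (Q.Γ i x z) + Q.K i x z) '' Q.Z i x) := by
  refine ⟨-B + κ₀, ?_⟩
  rintro _ ⟨z, hz, rfl⟩
  exact add_le_add (hu _) (h2.2.2.2.2.2 i x z hz)

lemma H2.Mop_le (h2 : H2 Q κ₀) {u : Fin M → E d → ℝ} {B : ℝ} {i : Fin M}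
    (hu : ∀ x, -B ≤ u i x) {x : E d} {z : 𝒵} (hz : z ∈ Q.Z i x) :
    Q.Mop i u x ≤ u i (Q.Γ i x z) + Q.K i x z :=
  csInf_le (h2.bddBelow hu x) ⟨z, hz, rfl⟩

lemma H2.le_Mop (h2 : H2 Q κ₀) {u : Fin M → E d → ℝ} {i : Fin M} {x : E d} {c : ℝ}
    (h : ∀ z ∈ Q.Z i x, c ≤ u i (Q.Γ i x z) + Q.K i x z) : c ≤ Q.Mop i u x :=
  le_csInf ((h2.2.1 i x).1.image _) (by rintro _ ⟨z, hz, rfl⟩; exact h z hz)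

lemma H2.exists_lt_of_Mop_lt (h2 : H2 Q κ₀) {u : Fin M → E d → ℝ} {i : Fin M} {x : E d} {c : ℝ}
    (h : Q.Mop i u x < c) : ∃ z ∈ Q.Z i x, u i (Q.Γ i x z) + Q.K i x z < c := by
  obtain ⟨_, ⟨z, hz, rfl⟩, hlt⟩ := exists_lt_of_csInf_lt ((h2.2.1 i x).1.image _) h
  exact ⟨z, hz, hlt⟩

/-- `g` dominates the upper relaxed limit of `f` along `l`. -/
def RelUpper {ι : Type*} (l : Filter ι) (f : ι → E d → ℝ) (g : E d → ℝ) : Prop :=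
  ∀ y c, g y < c → ∀ᶠ q in l ×ˢ 𝓝 y, f q.1 q.2 < c

/-- `g` is dominated by the lower relaxed limit of `f` along `l`. -/
def RelLower {ι : Type*} (l : Filter ι) (f : ι → E d → ℝ) (g : E d → ℝ) : Prop :=
  ∀ y c, c < g y → ∀ᶠ q in l ×ˢ 𝓝 y, c < f q.1 q.2

lemma RelUpper.eventually {ι : Type*} {l : Filter ι} {f : ι → E d → ℝ} {g : E d → ℝ}
    (h : RelUpper l f g) {X : ι → E d} {x : E d} (hX : Tendsto X l (𝓝 x)) {c : ℝ} (hc : g x < c) :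
    ∀ᶠ k in l, f k (X k) < c :=
  (tendsto_id.prodMk hX).eventually (h x c hc)

lemma RelLower.eventually {ι : Type*} {l : Filter ι} {f : ι → E d → ℝ} {g : E d → ℝ}
    (h : RelLower l f g) {X : ι → E d} {x : E d} (hX : Tendsto X l (𝓝 x)) {c : ℝ} (hc : c < g x) :
    ∀ᶠ k in l, c < f k (X k) :=
  (tendsto_id.prodMk hX).eventually (h x c hc)

lemma H2.hausdorffEDist_ne_top (h2 : H2 Q κ₀) (i : Fin M) (x y : E d) :
    Metric.hausdorffEDist (Q.Z i x) (Q.Z i y) ≠ ⊤ :=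
  Metric.hausdorffEDist_ne_top_of_nonempty_of_bounded (h2.2.1 i x).1 (h2.2.1 i y).1
    (h2.2.1 i x).2.isBounded (h2.2.1 i y).2.isBounded

lemma H2.eventually_hausdorffDist_lt (h2 : H2 Q κ₀) {ι : Type*} {l : Filter ι} (i : Fin M)
    {X : ι → E d} {x : E d} (hX : Tendsto X l (𝓝 x)) {r : ℝ} (hr : 0 < r) :
    ∀ᶠ k in l, Metric.hausdorffDist (Q.Z i x) (Q.Z i (X k)) < r := by
  obtain ⟨δ, hδ, h⟩ := h2.2.2.2.2.1 i x r hr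
  filter_upwards [hX.eventually (Metric.ball_mem_nhds x hδ)] with k hk using h _ hk

lemma H2.tendsto_Γ (h2 : H2 Q κ₀) {ι : Type*} {l : Filter ι} (i : Fin M)
    {X : ι → E d} {x : E d} (hX : Tendsto X l (𝓝 x)) (z : 𝒵) :
    Tendsto (fun q : ι × 𝒵 => (q.1, Q.Γ i (X q.1) q.2)) (l ×ˢ 𝓝 z) (l ×ˢ 𝓝 (Q.Γ i x z)) :=
  tendsto_fst.prodMk (((h2.2.2.1 i).tendsto (x, z)).comp
    ((hX.comp tendsto_fst).prodMk_nhds tendsto_snd))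

lemma H2.tendsto_K (h2 : H2 Q κ₀) {ι : Type*} {l : Filter ι} (i : Fin M)
    {X : ι → E d} {x : E d} (hX : Tendsto X l (𝓝 x)) (z : 𝒵) :
    Tendsto (fun q : ι × 𝒵 => Q.K i (X q.1) q.2) (l ×ˢ 𝓝 z) (𝓝 (Q.K i x z)) :=
  ((h2.2.2.2.1 i).tendsto (x, z)).comp ((hX.comp tendsto_fst).prodMk_nhds tendsto_snd)

lemma H2.Mop_upper (h2 : H2 Q κ₀) {ι : Type*} {l : Filter ι} {f : ι → Fin M → E d → ℝ}
    {g : Fin M → E d → ℝ} {i : Fin M} {B : ℝ} (hB : ∀ k x, -B ≤ f k i x)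
    (hf : RelUpper l (fun k => f k i) (g i)) {X : ι → E d} {x : E d} (hX : Tendsto X l (𝓝 x))
    {c : ℝ} (hc : Q.Mop i g x < c) : ∀ᶠ k in l, Q.Mop i (f k) (X k) < c := by
  obtain ⟨z, hz, hlt⟩ := h2.exists_lt_of_Mop_lt hc
  set η := (c - (g i (Q.Γ i x z) + Q.K i x z)) / 2 with hη
  have hη0 : 0 < η := by rw [hη]; linarith
  have e1 := (h2.tendsto_Γ i hX z).eventually (hf _ (g i (Q.Γ i x z) + η) (by linarith))
  have e2 := (h2.tendsto_K i hX z).eventually (gt_mem_nhds (lt_add_of_pos_right _ hη0))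
  obtain ⟨U, hU, V, hV, hUV⟩ := mem_prod_iff.1 (e1.and e2)
  obtain ⟨r, hr, hrV⟩ := Metric.mem_nhds_iff.1 hV
  filter_upwards [hU, h2.eventually_hausdorffDist_lt i hX hr] with k hk hd
  obtain ⟨z', hz', hzz'⟩ :=
    Metric.exists_dist_lt_of_hausdorffDist_lt hz hd (h2.hausdorffEDist_ne_top i x (X k))
  have h3 := h2.Mop_le (hB k) hz'
  have h4 := hUV (Set.mk_mem_prod hk (hrV (Metric.mem_ball'.2 hzz')))
  have h5 : f k i (Q.Γ i (X k) z') < _ := h4.1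
  have h6 : Q.K i (X k) z' < _ := h4.2
  linarith

lemma H2.Mop_lower (h2 : H2 Q κ₀) {ι : Type*} {l : Filter ι} {f : ι → Fin M → E d → ℝ}
    {g : Fin M → E d → ℝ} {i : Fin M} {B : ℝ} (hB : ∀ x, -B ≤ g i x)
    (hf : RelLower l (fun k => f k i) (g i)) {X : ι → E d} {x : E d} (hX : Tendsto X l (𝓝 x))
    {c : ℝ} (hc : c < Q.Mop i g x) : ∀ᶠ k in l, c ≤ Q.Mop i (f k) (X k) := by
  have key : {q : ι × 𝒵 | c < f q.1 i (Q.Γ i (X q.1) q.2) + Q.K i (X q.1) q.2}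
      ∈ l ×ˢ 𝓝ˢ (Q.Z i x) := by
    refine (h2.2.1 i x).2.mem_prod_nhdsSet_of_forall fun z hz => ?_
    have hlt := hc.trans_le (h2.Mop_le hB hz)
    set η := (g i (Q.Γ i x z) + Q.K i x z - c) / 2 with hη
    have hη0 : 0 < η := by rw [hη]; linarith
    filter_upwards [(h2.tendsto_Γ i hX z).eventually (hf _ (g i (Q.Γ i x z) - η) (by linarith)),
      (h2.tendsto_K i hX z).eventually (lt_mem_nhds (sub_lt_self _ hη0))] with q h5 h6
    linarith
  obtain ⟨U, hU, V, hV, hUV⟩ := mem_prod_iff.1 key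
  obtain ⟨r, hr, hrV⟩ := (Metric.hasBasis_nhdsSet_thickening (h2.2.1 i x).2).mem_iff.1 hV
  filter_upwards [hU, h2.eventually_hausdorffDist_lt i hX hr] with k hk hd
  refine h2.le_Mop fun z hz => ?_
  obtain ⟨z', hz', hzz'⟩ :=
    Metric.exists_dist_lt_of_hausdorffDist_lt' hz hd (h2.hausdorffEDist_ne_top i x (X k))
  have hzV := hrV (Metric.mem_thickening_iff.2 ⟨z', hz', by rwa [dist_comm]⟩)
  exact (hUV (Set.mk_mem_prod hk hzV)).le

/-- The ways of combining the Hamiltonian and the obstacle that are covered by the theory. -/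
structure IsCombiner (Φ : ℝ → ℝ → ℝ) : Prop where
  mono : ∀ {h h' o o'}, h ≤ h' → o ≤ o' → Φ h o ≤ Φ h' o'
  smul : ∀ {t} h o, 0 ≤ t → Φ (t * h) (t * o) = t * Φ h o
  lt_add : ∀ {t} h o, 0 < t → Φ h o < Φ (h + t) (o + t)

/-- The operator combining the Hamiltonian and the obstacle through `Φ`. -/
def combOp (P : HJBData d d' M 𝒜) (Q : ImpulseData d M 𝒵) (Φ : ℝ → ℝ → ℝ) : Op d M :=
  fun i x u p X => Φ (P.Ham i x (fun j => u j x) p X) (u i x - Q.Mop i u x)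

lemma isCombiner_max : IsCombiner max where
  mono h o := max_le_max h o
  smul _ _ ht := (mul_max_of_nonneg _ _ ht).symm
  lt_add _ _ ht := max_lt_max (lt_add_of_pos_right _ ht) (lt_add_of_pos_right _ ht)

lemma isCombiner_penalty {ρ : ℝ} (hρ : 0 ≤ ρ) : IsCombiner fun h o => h + ρ * max o 0 where
  mono h o := add_le_add h (mul_le_mul_of_nonneg_left (max_le_max_right 0 o) hρ)
  smul {t} h o ht := by
    have := mul_max_of_nonneg o 0 ht
    rw [mul_zero] at this
    rw [← this]; ring
  lt_add {t} h o ht := by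
    refine add_lt_add_of_lt_of_le (lt_add_of_pos_right _ ht) (mul_le_mul_of_nonneg_left ?_ hρ)
    exact max_le_max_right 0 (by linarith)

end Operators

section Comparison

variable {P : HJBData d d' M 𝒜} {Q : ImpulseData d M 𝒵} {C lam0 κ₀ : ℝ}

lemma relUpper_of_upperSemicontinuous {g : E d → ℝ} (hg : UpperSemicontinuous g) {ι : Type*}
    (l : Filter ι) : RelUpper l (fun _ => g) g :=
  fun y c hc => (hg y c hc).prod_inr l

lemma relLower_of_lowerSemicontinuous {g : E d → ℝ} (hg : LowerSemicontinuous g) {ι : Type*}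
    (l : Filter ι) : RelLower l (fun _ => g) g :=
  fun y c hc => (hg y c hc).prod_inr l

lemma H2.Mop_le_Mop_add (h2 : H2 Q κ₀) {w v : Fin M → E d → ℝ} {B θ : ℝ} {i : Fin M}
    (hw : ∀ x, -B ≤ w i x) (h : ∀ x, w i x - v i x ≤ θ) (x : E d) :
    Q.Mop i w x ≤ Q.Mop i v x + θ := by
  rw [← sub_le_iff_le_add]
  refine h2.le_Mop fun z hz => ?_
  have := h2.Mop_le hw hz
  linarith [h (Q.Γ i x z)]

lemma norm_add_three_sq_le {F : Type*} [SeminormedAddCommGroup F] (x y a b : F) :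
    ‖a - b‖ ^ 2 ≤ 3 * (‖x - a‖ ^ 2 + ‖y - b‖ ^ 2 + ‖x - y‖ ^ 2) := by
  have h : ‖a - b‖ ≤ ‖x - a‖ + ‖y - b‖ + ‖x - y‖ := by
    have e : a - b = -(x - a) + (y - b) + (x - y) := by abel
    rw [e]
    exact (norm_add_le _ _).trans (add_le_add_left ((norm_add_le _ _).trans (by rw [norm_neg])) _)
  have h0 := norm_nonneg (a - b)
  nlinarith [sq_nonneg (‖x - a‖ - ‖y - b‖), sq_nonneg (‖x - a‖ - ‖x - y‖),
    sq_nonneg (‖y - b‖ - ‖x - y‖)]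

/-- Doubling of variables near an almost maximum point `x₀` of `w i - v i`, with all error terms
controlled by the single parameter `β`. -/
lemma H2.exists_doubling (h2 : H2 Q κ₀) {w v : Fin M → E d → ℝ} {B θ β : ℝ}
    (hw : ∀ j, UpperSemicontinuous (w j)) (hv : ∀ j, LowerSemicontinuous (v j))
    (hwB : ∀ j x, |w j x| ≤ B) (hvB : ∀ j x, |v j x| ≤ B) (hθ : ∀ j x, w j x - v j x ≤ θ)
    (hβ : 0 < β) (hβ1 : β ≤ 1) (i : Fin M) (x₀ : E d) (hx₀ : θ - β ≤ w i x₀ - v i x₀) :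
    ∃ (κ : ℝ) (a b p r : E d) (X Y : E d →L[ℝ] E d), 0 < κ ∧ ‖a - b‖ ≤ β ∧
      κ * ‖a - b‖ ^ 2 ≤ 18 * β ∧ ‖p + r‖ ≤ 8 * β ∧ ‖a - b‖ * ‖r‖ ≤ 25 * β ∧
      θ - 2 * β ≤ w i a - v i b ∧ (∀ j, w j a - v j b ≤ θ + β) ∧
      Q.Mop i w a - Q.Mop i v b ≤ θ + β ∧
      (∀ h k, 1 / 2 * ⟪X h, h⟫ + 1 / 2 * ⟪Y k, k⟫
        ≤ κ * ‖h - k‖ ^ 2 + 2 * β * ‖h‖ ^ 2 + β * ‖k‖ ^ 2) ∧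
      IsLocalMax (fun y => w i y - quadTest a p X y) a ∧
      IsLocalMin (fun y => v i y - quadTest b (-r) (-Y) y) b := by
  have hz : UpperSemicontinuous (fun x => -v i x) := fun x c hc => by
    filter_upwards [hv i x (-c) (by linarith)] with y hy using by linarith
  have hzB : ∀ x, |-v i x| ≤ B := fun x => by rw [abs_neg]; exact hvB i x
  choose x y a b p r X Y h1 h2' h3 h4 h5 h6 using fun n : ℕ =>
    exists_quadTest_pair (by positivity : (0 : ℝ) < n + 1) hβ hβ x₀ (hw i) (hwB i) hz hzB
  have hB0 : 0 ≤ B := (abs_nonneg _).trans (hwB i 0)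
  set D := 4 * B + β with hD
  set T := fun n => ‖x n - a n‖ ^ 2 + ‖y n - b n‖ ^ 2 + ‖x n - y n‖ ^ 2 with hT
  have hT0 : ∀ n, 0 ≤ T n := fun n => by positivity
  have hen : ∀ n : ℕ, (n + 1 : ℝ) / 2 * T n + β / 2 * ‖x n - x₀‖ ^ 2 ≤ D := fun n => by
    have := h1 n
    linarith [abs_le.1 (hwB i x₀), abs_le.1 (hzB x₀), abs_le.1 (hwB i (a n)),
      abs_le.1 (hzB (b n))]
  have hTn : ∀ n : ℕ, T n ≤ 2 * D / (n + 1) := fun n => by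
    rw [le_div_iff₀ (by positivity)]
    have : 0 ≤ β / 2 * ‖x n - x₀‖ ^ 2 := by positivity
    linarith [hen n]
  have hab : ∀ n, ‖a n - b n‖ ^ 2 ≤ 3 * T n := fun n => norm_add_three_sq_le _ _ _ _
  have hlim0 : Tendsto (fun n => ‖a n - b n‖) atTop (𝓝 0) := by
    have hs : Tendsto (fun n : ℕ => Real.sqrt (3 * (2 * D / ((n : ℝ) + 1)))) atTop (𝓝 0) := by
      have := (tendsto_one_div_add_atTop_nhds_zero_nat (𝕜 := ℝ)).const_mul (3 * (2 * D))
      have := (Real.continuous_sqrt.tendsto _).comp this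
      simp only [mul_zero, Real.sqrt_zero] at this
      refine this.congr fun n => ?_
      simp only [Function.comp]
      congr 1; ring
    refine squeeze_zero (fun n => norm_nonneg _) (fun n => ?_) hs
    refine Real.le_sqrt_of_sq_le ((hab n).trans ?_)
    exact mul_le_mul_of_nonneg_left (hTn n) (by norm_num)
  have hbdd : ∀ n, a n ∈ Metric.closedBall x₀ ((2 * D / β + 1) + (2 * D + 1)) := fun n => by
    have k0 : (1 : ℝ) ≤ n + 1 := by linarith [n.cast_nonneg (α := ℝ)]
    have k1 : ‖x n - a n‖ ^ 2 ≤ 2 * D := by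
      have h0 : ‖x n - a n‖ ^ 2 ≤ T n := by
        simp only [hT]; nlinarith [sq_nonneg ‖y n - b n‖, sq_nonneg ‖x n - y n‖]
      have : 0 ≤ β / 2 * ‖x n - x₀‖ ^ 2 := by positivity
      nlinarith [hen n, hT0 n]
    have k2 : ‖x n - x₀‖ ^ 2 ≤ 2 * D / β := by
      rw [le_div_iff₀ hβ]
      have : 0 ≤ (n + 1 : ℝ) / 2 * T n := mul_nonneg (by positivity) (hT0 n)
      linarith [hen n]
    rw [Metric.mem_closedBall]
    have k3 := dist_triangle (a n) (x n) x₀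
    rw [dist_eq_norm (x n) x₀, dist_comm (a n) (x n), dist_eq_norm (x n) (a n)] at k3
    linarith [two_mul_le_add_sq ‖x n - a n‖ 1, two_mul_le_add_sq ‖x n - x₀‖ 1,
      sq_nonneg ‖x n - a n‖, sq_nonneg ‖x n - x₀‖]
  obtain ⟨xb, -, ψ, hψ, hlim⟩ := (isCompact_closedBall x₀ _).tendsto_subseq hbdd
  have hlima : Tendsto (fun n => a (ψ n)) atTop (𝓝 xb) := hlim
  have hlimab := hlim0.comp hψ.tendsto_atTop
  have hlimb : Tendsto (fun n => b (ψ n)) atTop (𝓝 xb) := by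
    have := hlima.sub (tendsto_zero_iff_norm_tendsto_zero.2 hlimab)
    simpa using this
  have ev1 : ∀ᶠ n in atTop, ∀ j, w j (a (ψ n)) - v j (b (ψ n)) ≤ θ + β := by
    refine eventually_all.2 fun j => ?_
    filter_upwards [(relUpper_of_upperSemicontinuous (hw j) atTop).eventually hlima
        (c := w j xb + β / 2) (by linarith),
      (relLower_of_lowerSemicontinuous (hv j) atTop).eventually hlimb
        (c := v j xb - β / 2) (by linarith)] with n k1 k2
    linarith [hθ j xb]
  have ev2 : ∀ᶠ n in atTop, Q.Mop i w (a (ψ n)) - Q.Mop i v (b (ψ n)) ≤ θ + β := by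
    have hwl : ∀ x, -B ≤ w i x := fun x => (abs_le.1 (hwB i x)).1
    have hvl : ∀ x, -B ≤ v i x := fun x => (abs_le.1 (hvB i x)).1
    filter_upwards [h2.Mop_upper (f := fun _ => w) (fun _ => hwl)
      (relUpper_of_upperSemicontinuous (hw i) atTop) hlima (c := Q.Mop i w xb + β / 2) (by linarith),
      h2.Mop_lower (f := fun _ => v) hvl
      (relLower_of_lowerSemicontinuous (hv i) atTop) hlimb
      (c := Q.Mop i v xb - β / 2) (by linarith)] with n k1 k2
    linarith [h2.Mop_le_Mop_add hwl (hθ i) xb]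
  have ev3 := hlimab.eventually (ge_mem_nhds hβ)
  obtain ⟨n', k1, k2, k3⟩ := (ev1.and (ev2.and ev3)).exists
  set n := ψ n'
  have e1 := h1 n
  have k1i := k1 i
  have hTβ : (n + 1 : ℝ) / 2 * T n + β / 2 * ‖x n - x₀‖ ^ 2 ≤ 3 * β := by linarith
  have hTn0 : 0 ≤ (n + 1 : ℝ) / 2 * T n := mul_nonneg (by positivity) (hT0 n)
  have hr : ‖x n - x₀‖ ≤ 3 := by
    have : β * ‖x n - x₀‖ ^ 2 ≤ β * 6 := by linarith
    have := le_of_mul_le_mul_left this hβ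
    nlinarith [norm_nonneg (x n - x₀)]
  have hr0 : 0 ≤ β / 2 * ‖x n - x₀‖ ^ 2 := by positivity
  have hκab : (n + 1 : ℝ) * ‖a n - b n‖ ^ 2 ≤ 18 * β := by
    have := mul_le_mul_of_nonneg_left (hab n) (by positivity : (0 : ℝ) ≤ n + 1)
    linarith
  have hκs : (n + 1 : ℝ) * ‖x n - y n‖ ^ 2 ≤ 6 * β := by
    have k : ‖x n - y n‖ ^ 2 ≤ T n := by
      simp only [hT]; nlinarith [sq_nonneg ‖y n - b n‖, sq_nonneg ‖x n - a n‖]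
    have := mul_le_mul_of_nonneg_left k (by positivity : (0 : ℝ) ≤ n + 1)
    linarith
  refine ⟨n + 1, a n, b n, p n, r n, X n, Y n, by positivity, k3, hκab, ?_, ?_, ?_, k1, k2, ?_,
    h5 n, ?_⟩
  · nlinarith [h2' n]
  · have h3n := mul_le_mul_of_nonneg_left (h3 n) (norm_nonneg (a n - b n))
    have k3' : ‖a n - b n‖ ≤ β := k3
    have : 0 ≤ (n + 1 : ℝ) * (‖a n - b n‖ - ‖x n - y n‖) ^ 2 := by positivity
    nlinarith [norm_nonneg (a n - b n)]
  · have : 0 ≤ T n := hT0 n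
    linarith
  · intro h k
    linarith [h4 n h k]
  · filter_upwards [h6 n] with q hq
    simp only [quadTest, inner_neg_left, _root_.neg_apply] at hq ⊢
    linarith

lemma zpart_sub_const (P : HJBData d d' M 𝒜) (i : Fin M) (α : 𝒜) (x : E d) (s : Fin M → ℝ)
    (θ : ℝ) : P.zpart i α x (fun j => s j - θ)
      = P.zpart i α x s - θ * (P.cz i α x - ∑ j ∈ Finset.univ.erase i, P.dcp i j α x) := by
  simp only [HJBData.zpart, mul_sub, Finset.sum_sub_distrib, ← Finset.sum_mul]
  ring

lemma zpart_smul (P : HJBData d d' M 𝒜) (i : Fin M) (α : 𝒜) (x : E d) (s : Fin M → ℝ)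
    (t : ℝ) : P.zpart i α x (fun j => t * s j)
      = t * P.zpart i α x s - (1 - t) * P.runCost i α x := by
  have : ∑ j ∈ Finset.univ.erase i, P.dcp i j α x * (t * s j)
      = t * ∑ j ∈ Finset.univ.erase i, P.dcp i j α x * s j := by
    rw [Finset.mul_sum]
    exact Finset.sum_congr rfl fun j _ => by ring
  simp only [HJBData.zpart, this]
  ring

/-- Difference of the derivative parts at the two points produced by doubling of variables. -/
lemma H1.dpart_quadTest_le (h1 : H1 P C lam0) {i : Fin M} {α : 𝒜} (hα : α ∈ P.A i)
    {κ β μ : ℝ} {a b p r : E d} {X Y : E d →L[ℝ] E d} (hκ : 0 < κ) (hβ : 0 < β) (hμ : 0 < μ)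
    (hab : κ * ‖a - b‖ ^ 2 ≤ 18 * β) (hpr : ‖p + r‖ ≤ 8 * β) (hr : ‖a - b‖ * ‖r‖ ≤ 25 * β)
    (hXY : ∀ h k, 1 / 2 * ⟪X h, h⟫ + 1 / 2 * ⟪Y k, k⟫
        ≤ κ * ‖h - k‖ ^ 2 + 2 * β * ‖h‖ ^ 2 + β * ‖k‖ ^ 2) :
    P.dpart i α b (-r) (hess (quadTest b (-r) (-Y)) b)
      ≤ μ * P.dpart i α a (μ⁻¹ • p) (hess (quadTest a (μ⁻¹ • p) (μ⁻¹ • X)) a)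
        + (21 * C ^ 2 + 33 * C) * β := by
  have hC := h1.nonneg i
  obtain ⟨-, -, -, -, -, hσ, hσl, hb, hbl, -⟩ := h1.2.2 i α hα
  simp only [HJBData.dpart, trace_hess_quadTest, _root_.smul_apply, _root_.neg_apply,
    inner_neg_left, inner_neg_right, real_inner_smul_left, real_inner_smul_right,
    Finset.sum_neg_distrib, ← Finset.mul_sum]
  have e1 : μ * (-(1 / 2 * (μ⁻¹ * ∑ l, ⟪X (colVec (P.σm i α a) l), colVec (P.σm i α a) l⟫))
      - μ⁻¹ * ⟪P.bv i α a, p⟫)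
      = -(1 / 2 * ∑ l, ⟪X (colVec (P.σm i α a) l), colVec (P.σm i α a) l⟫)
        - ⟪P.bv i α a, p⟫ := by
    field_simp
  rw [e1]
  have k1 : 1 / 2 * ∑ l, ⟪X (colVec (P.σm i α a) l), colVec (P.σm i α a) l⟫
      + 1 / 2 * ∑ l, ⟪Y (colVec (P.σm i α b) l), colVec (P.σm i α b) l⟫ ≤ 21 * C ^ 2 * β := by
    have sq_le {A : Matrix (Fin d) (Fin d') ℝ} {D : ℝ} (h : frobNorm A ≤ D) :
        ∑ l, ‖colVec A l‖ ^ 2 ≤ D ^ 2 := by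
      rw [sum_norm_colVec_sq]; exact pow_le_pow_left₀ (frobNorm_nonneg _) h 2
    have s1 := mul_le_mul_of_nonneg_left (sq_le (hσl a b)) hκ.le
    have s2 := mul_le_mul_of_nonneg_left (sq_le (hσ a)) (by positivity : 0 ≤ 2 * β)
    have s3 := mul_le_mul_of_nonneg_left (sq_le (hσ b)) hβ.le
    have s4 := Finset.sum_le_sum fun l (_ : l ∈ Finset.univ) =>
      hXY (colVec (P.σm i α a) l) (colVec (P.σm i α b) l)
    have hsub : ∀ l, colVec (P.σm i α a) l - colVec (P.σm i α b) l
        = colVec (P.σm i α a - P.σm i α b) l := fun l => rfl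
    simp only [Finset.sum_add_distrib, ← Finset.mul_sum, hsub] at s4
    have s5 := mul_le_mul_of_nonneg_left hab (sq_nonneg C)
    nlinarith
  have k2 : ⟪P.bv i α a, p⟫ + ⟪P.bv i α b, r⟫ ≤ 33 * C * β := by
    have e2 : ⟪P.bv i α a, p⟫ + ⟪P.bv i α b, r⟫
        = ⟪P.bv i α a, p + r⟫ + ⟪P.bv i α b - P.bv i α a, r⟫ := by
      rw [inner_add_right, inner_sub_left]; ring
    have t1 := (real_inner_le_norm (P.bv i α a) (p + r)).trans
      (mul_le_mul (hb a) hpr (norm_nonneg _) hC)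
    have t2 := (real_inner_le_norm (P.bv i α b - P.bv i α a) r).trans
      (mul_le_mul_of_nonneg_right (hbl b a) (norm_nonneg _))
    rw [norm_sub_rev b a, mul_assoc] at t2
    have t3 := mul_le_mul_of_nonneg_left hr hC
    linarith
  linarith

/-- Comparison principle for bounded semicontinuous sub- and supersolutions. -/
theorem comparison (h1 : H1 P C lam0) (h2 : H2 Q κ₀) {Φ : ℝ → ℝ → ℝ} (hΦ : IsCombiner Φ)
    {u v : Fin M → E d → ℝ} {B₀ : ℝ}
    (hu : ∀ j, UpperSemicontinuous (u j)) (hv : ∀ j, LowerSemicontinuous (v j))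
    (huB : ∀ j x, |u j x| ≤ B₀) (hvB : ∀ j x, |v j x| ≤ B₀)
    (hsub : QuadSub (combOp P Q Φ) u) (hsup : QuadSuper (combOp P Q Φ) v) (i₀ : Fin M) (z₀ : E d) :
    u i₀ z₀ ≤ v i₀ z₀ := by
  by_contra! hlt
  have hC := h1.nonneg i₀
  obtain ⟨B, hBB₀, hB⟩ : ∃ B, B₀ ≤ B ∧ C + 1 ≤ B * lam0 :=
    ⟨max B₀ ((C + 1) / lam0), le_max_left _ _, by
      rw [← div_le_iff₀ h1.1]; exact le_max_right _ _⟩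
  have hB0 : 0 ≤ B := ((abs_nonneg _).trans (huB i₀ z₀)).trans hBB₀
  obtain ⟨μ, hμ, hμ1, hμγ⟩ : ∃ μ, 0 < μ ∧ μ ≤ 1 / 2 ∧ μ * (2 * B) < u i₀ z₀ - v i₀ z₀ := by
    have ht : Tendsto (fun μ : ℝ => μ * (2 * B)) (𝓝[>] 0) (𝓝 0) := by
      have : Continuous fun μ : ℝ => μ * (2 * B) := by fun_prop
      simpa using (this.tendsto 0).mono_left nhdsWithin_le_nhds
    obtain ⟨μ, ⟨a1, a2⟩, a3⟩ := ((ht.eventually (gt_mem_nhds (sub_pos.2 hlt))).and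
      (nhdsWithin_le_nhds (ge_mem_nhds (by norm_num : (0 : ℝ) < 1 / 2)))).and
      self_mem_nhdsWithin |>.exists
    exact ⟨μ, a3, a2, a1⟩
  set w : Fin M → E d → ℝ := fun j x => (1 - μ) * u j x - μ * B with hwdef
  have huB' : ∀ j x, |u j x| ≤ B := fun j x => (huB j x).trans hBB₀
  have hvB' : ∀ j x, |v j x| ≤ B := fun j x => (hvB j x).trans hBB₀
  have hwB : ∀ j x, |w j x| ≤ B := fun j x => by
    have := abs_le.1 (huB' j x)
    rw [abs_le]; constructor <;> simp only [hwdef] <;> nlinarith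
  have hw : ∀ j, UpperSemicontinuous (w j) := fun j x c hc => by
    have h0 : u j x < (c + μ * B) / (1 - μ) := by
      rw [lt_div_iff₀ (by linarith)]; simp only [hwdef] at hc; linarith
    filter_upwards [hu j x _ h0] with y hy
    rw [lt_div_iff₀ (by linarith)] at hy
    simp only [hwdef]; linarith
  obtain ⟨θ, hθ⟩ : ∃ θ, IsLUB (Set.range fun q : Fin M × E d => w q.1 q.2 - v q.1 q.2) θ :=
    Real.exists_isLUB ⟨_, (i₀, z₀), rfl⟩ ⟨2 * B, by
      rintro _ ⟨q, rfl⟩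
      linarith [abs_le.1 (hwB q.1 q.2), abs_le.1 (hvB' q.1 q.2)]⟩
  have hθle : ∀ j x, w j x - v j x ≤ θ := fun j x => hθ.1 ⟨(j, x), rfl⟩
  have hθ0 : 0 < θ := by
    refine lt_of_lt_of_le ?_ (hθle i₀ z₀)
    have := abs_le.1 (huB' i₀ z₀)
    simp only [hwdef]; nlinarith
  have hθB : θ ≤ 2 * B := hθ.2 (by
    rintro _ ⟨q, rfl⟩
    linarith [abs_le.1 (hwB q.1 q.2), abs_le.1 (hvB' q.1 q.2)])
  set K := 21 * C ^ 2 + 33 * C + 2 * (C * (3 * B) + 2 * C + M * (C * (3 * B) + C)) + 3 with hK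
  have hK0 : 0 < K := by rw [hK]; positivity
  obtain ⟨β, hβ, hβ1, hβμ, hβκ⟩ : ∃ β, 0 < β ∧ β ≤ 1 ∧ K * β < μ ∧ K * β < μ * κ₀ := by
    refine ⟨min 1 (min μ (μ * κ₀) / (2 * K)), ?_, min_le_left _ _, ?_⟩
    · have := mul_pos hμ h2.1
      positivity
    · have hm : 0 < min μ (μ * κ₀) := lt_min hμ (mul_pos hμ h2.1)
      have : K * min 1 (min μ (μ * κ₀) / (2 * K)) < min μ (μ * κ₀) := by
        refine (mul_le_mul_of_nonneg_left (min_le_right _ _) hK0.le).trans_lt ?_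
        have e : K * (min μ (μ * κ₀) / (2 * K)) = min μ (μ * κ₀) / 2 := by field_simp
        rw [e]; linarith
      exact ⟨this.trans_le (min_le_left _ _), this.trans_le (min_le_right _ _)⟩
  obtain ⟨_, ⟨⟨i, x₀⟩, rfl⟩, hx₀, -⟩ := hθ.exists_between (sub_lt_self θ hβ)
  obtain ⟨κ, a, b, p, r, X, Y, hκ, k1, k2, k3, k4, k5, k6, k7, k8, k9, k10⟩ :=
    h2.exists_doubling hw hv hwB hvB' hθle hβ hβ1 i x₀ hx₀.le
  have hμ' : 0 < 1 - μ := by linarith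
  have hu0 := hsub i a ((1 - μ)⁻¹ • p) ((1 - μ)⁻¹ • X) (by
    filter_upwards [k9] with y hy
    have e : ∀ y, w i y - quadTest a p X y
        = (1 - μ) * (u i y - quadTest a ((1 - μ)⁻¹ • p) ((1 - μ)⁻¹ • X) y) - μ * B := fun y => by
      simp only [hwdef, quadTest, _root_.smul_apply, real_inner_smul_left]
      field_simp
      ring
    rw [e, e] at hy
    exact le_of_mul_le_mul_left (by linarith) hμ')
  have hv0 := hsup i b (-r) (-Y) k10
  set hu' := P.Ham i a (fun j => u j a) ((1 - μ)⁻¹ • p)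
    (hess (quadTest a ((1 - μ)⁻¹ • p) ((1 - μ)⁻¹ • X)) a) with hu'def
  set hv' := P.Ham i b (fun j => v j b) (-r) (hess (quadTest b (-r) (-Y)) b) with hv'def
  have hham : hv' ≤ (1 - μ) * hu' - μ + K * β := by
    refine h1.Ham_le fun α hα => ?_
    have a1 := mul_le_mul_of_nonneg_left (h1.le_Ham hα a (fun j => u j a) ((1 - μ)⁻¹ • p)
      (hess (quadTest a ((1 - μ)⁻¹ • p) ((1 - μ)⁻¹ • X)) a)) hμ'.le
    rw [HJBData.L_eq, mul_add] at a1
    have a2 := h1.dpart_quadTest_le hα hκ hβ hμ' k2 k3 k4 k8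
    have a3 := h1.zpart_le hα (B := 3 * B) (e := 2 * β) (x := b) (y := a)
      (s := fun j => v j b) (t := fun j => w j a - θ)
      (by rw [norm_sub_rev]; linarith) (fun j => by linarith [hvB' j b])
      (fun j => by
        have := abs_le.1 (hwB j a)
        rw [abs_le]; constructor <;> linarith)
      (by linarith) (fun j _ => by linarith [k6 j])
    obtain ⟨-, -, -, -, -, -, -, -, -, -, -, hl, -, -, -, hlam⟩ := h1.2.2 i α hα
    rw [zpart_sub_const, show (fun j => w j a) = fun j => (1 - μ) * u j a - μ * B from rfl,
      zpart_sub_const, zpart_smul] at a3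
    have a4 := hlam a
    have a5 := (abs_le.1 (hl a)).1
    have a6 := mul_le_mul_of_nonneg_left a4 hθ0.le
    have a7 := mul_le_mul_of_nonneg_left a4 (mul_nonneg hμ.le hB0)
    have a8 := mul_pos hθ0 h1.1
    have a9 := mul_le_mul_of_nonneg_left a5 hμ.le
    have a10 := mul_le_mul_of_nonneg_left hB hμ.le
    rw [HJBData.L_eq]
    rw [hK]
    linarith
  have hobs : v i b - Q.Mop i v b ≤ (1 - μ) * (u i a - Q.Mop i u a) - μ * κ₀ + K * β := by
    have hM : (1 - μ) * Q.Mop i u a - μ * B + μ * κ₀ ≤ Q.Mop i w a := by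
      refine h2.le_Mop fun z hz => ?_
      have a1 := mul_le_mul_of_nonneg_left
        (h2.Mop_le (fun x => (abs_le.1 (huB' i x)).1) hz) hμ'.le
      have a2 := mul_le_mul_of_nonneg_left (h2.2.2.2.2.2 i a z hz) hμ.le
      simp only [hwdef]; linarith
    have hwi : w i a = (1 - μ) * u i a - μ * B := rfl
    have hKβ : 3 * β ≤ K * β := by
      refine mul_le_mul_of_nonneg_right ?_ hβ.le
      have : 0 ≤ 21 * C ^ 2 + 33 * C + 2 * (C * (3 * B) + 2 * C + M * (C * (3 * B) + C)) := by
        positivity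
      linarith
    linarith
  set t := min (μ - K * β) (μ * κ₀ - K * β) with ht
  have ht0 : 0 < t := lt_min (by linarith) (by linarith)
  have hfin := hΦ.lt_add hv' (v i b - Q.Mop i v b) ht0
  have hfin2 := hΦ.mono (h := hv' + t) (h' := (1 - μ) * hu') (o := v i b - Q.Mop i v b + t)
    (o' := (1 - μ) * (u i a - Q.Mop i u a))
    (by linarith [min_le_left (μ - K * β) (μ * κ₀ - K * β)])
    (by linarith [min_le_right (μ - K * β) (μ * κ₀ - K * β)])
  rw [hΦ.smul _ _ hμ'.le] at hfin2
  have hu1 : Φ hu' (u i a - Q.Mop i u a) ≤ 0 := hu0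
  have hv1 : 0 ≤ Φ hv' (v i b - Q.Mop i v b) := hv0
  nlinarith

end Comparison

section Stability

variable {P : HJBData d d' M 𝒜} {Q : ImpulseData d M 𝒵} {C lam0 κ₀ : ℝ}

/-- A local maximum point of `g - φ` is the limit of local maximum points of quartic perturbations
of `f k - φ`. -/
lemma exists_tendsto_isLocalMax {ι : Type*} {l : Filter ι} {f : ι → E d → ℝ} {g φ : E d → ℝ}
    (hf : ∀ k, UpperSemicontinuous (f k)) (hfg : RelUpper l f g) (hφ : Continuous φ) {x : E d}
    (hrec : ∀ c < g x, ∀ U ∈ 𝓝 x, ∀ᶠ k in l, ∃ y ∈ U, c < f k y)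
    (hx : IsLocalMax (fun y => g y - φ y) x) :
    ∃ Y : ι → E d, Tendsto Y l (𝓝 x) ∧ Tendsto (fun k => f k (Y k)) l (𝓝 (g x)) ∧
      ∀ᶠ k in l, IsLocalMax (fun y => f k y - (φ y + ‖y - x‖ ^ 4)) (Y k) := by
  obtain ⟨r, hr, hball⟩ := Metric.nhds_basis_closedBall.mem_iff.1 hx
  set ψ : E d → ℝ := fun y => φ y + ‖y - x‖ ^ 4 with hψdef
  have hψ : Continuous ψ := by fun_prop
  have hψx : ψ x = φ x := by simp [hψdef]
  have hmax : ∀ k, ∃ y ∈ Metric.closedBall x r,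
      IsMaxOn (fun y => f k y - ψ y) (Metric.closedBall x r) y := fun k => by
    refine UpperSemicontinuousOn.exists_isMaxOn ⟨x, Metric.mem_closedBall_self hr.le⟩
      (isCompact_closedBall x r) ?_
    simp only [sub_eq_add_neg]
    exact ((hf k).add hψ.neg.upperSemicontinuous).upperSemicontinuousOn _
  choose Y hYr hYmax using hmax
  have hlow : ∀ c < g x - ψ x, ∀ᶠ k in l, c < f k (Y k) - ψ (Y k) := fun c hc => by
    set η := (g x - ψ x - c) / 2 with hη
    have hη0 : 0 < η := by rw [hη]; linarith
    have hU := (hψ.tendsto x).eventually (gt_mem_nhds (lt_add_of_pos_right _ hη0))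
    filter_upwards [hrec (g x - η) (by linarith) _
      (inter_mem hU (Metric.closedBall_mem_nhds x hr))] with k ⟨y, ⟨hy1, hy2⟩, hy3⟩
    have h1 : f k y - ψ y ≤ f k (Y k) - ψ (Y k) := hYmax k hy2
    have h2 : ψ y < ψ x + η := hy1
    linarith
  have hYx : Tendsto Y l (𝓝 x) := by
    refine Metric.nhds_basis_ball.tendsto_right_iff.2 fun ε hε => ?_
    have hK : IsCompact (Metric.closedBall x r \ Metric.ball x ε) :=
      (isCompact_closedBall x r).diff Metric.isOpen_ball
    have hc0 : 0 < ε ^ 4 / 2 := by positivity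
    have key : {q : ι × E d | f q.1 q.2 - ψ q.2 < g x - ψ x - ε ^ 4 / 2}
        ∈ l ×ˢ 𝓝ˢ (Metric.closedBall x r \ Metric.ball x ε) := by
      refine hK.mem_prod_nhdsSet_of_forall fun y hy => ?_
      have h1 : g y - φ y ≤ g x - φ x := hball hy.1
      have h2 : ε ^ 4 ≤ ‖y - x‖ ^ 4 := by
        refine pow_le_pow_left₀ hε.le ?_ 4
        rw [← dist_eq_norm]
        exact not_lt.1 hy.2
      have h3 : ψ y = φ y + ‖y - x‖ ^ 4 := rfl
      have h4 : ∀ᶠ q in l ×ˢ 𝓝 y, ψ y - ε ^ 4 / 8 < ψ q.2 :=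
        (hψ.tendsto y).comp tendsto_snd |>.eventually (lt_mem_nhds (by linarith))
      filter_upwards [hfg y (g y + ε ^ 4 / 8) (by linarith), h4] with q h5 h6
      linarith
    obtain ⟨U, hU, V, hV, hUV⟩ := mem_prod_iff.1 key
    filter_upwards [hU, hlow (g x - ψ x - ε ^ 4 / 2) (by linarith)] with k hk hk'
    by_contra hcon
    exact lt_asymm hk' (hUV (Set.mk_mem_prod hk (subset_of_mem_nhdsSet hV ⟨hYr k, hcon⟩)))
  refine ⟨Y, hYx, tendsto_order.2 ⟨fun c hc => ?_, fun c hc => hfg.eventually hYx hc⟩, ?_⟩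
  · set η := (g x - c) / 2 with hη
    have hη0 : 0 < η := by rw [hη]; linarith
    filter_upwards [hlow (g x - ψ x - η) (by linarith),
      ((hψ.tendsto x).comp hYx).eventually (lt_mem_nhds (sub_lt_self _ hη0))] with k h1 h2
    have h3 : ψ x - η < ψ (Y k) := h2
    linarith
  · filter_upwards [hYx (Metric.ball_mem_nhds x hr)] with k hk
    exact (hYmax k).isLocalMax (mem_of_superset (Metric.isOpen_ball.mem_nhds hk)
      Metric.ball_subset_closedBall)

lemma RelLower.neg {ι : Type*} {l : Filter ι} {f : ι → E d → ℝ} {g : E d → ℝ}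
    (h : RelLower l f g) : RelUpper l (fun k y => -f k y) fun y => -g y := fun y c hc => by
  filter_upwards [h y (-c) (by linarith)] with q hq using by linarith

lemma exists_tendsto_isLocalMin {ι : Type*} {l : Filter ι} {f : ι → E d → ℝ} {g φ : E d → ℝ}
    (hf : ∀ k, LowerSemicontinuous (f k)) (hfg : RelLower l f g) (hφ : Continuous φ) {x : E d}
    (hrec : ∀ c, g x < c → ∀ U ∈ 𝓝 x, ∀ᶠ k in l, ∃ y ∈ U, f k y < c)
    (hx : IsLocalMin (fun y => g y - φ y) x) :
    ∃ Y : ι → E d, Tendsto Y l (𝓝 x) ∧ Tendsto (fun k => f k (Y k)) l (𝓝 (g x)) ∧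
      ∀ᶠ k in l, IsLocalMin (fun y => f k y - (φ y - ‖y - x‖ ^ 4)) (Y k) := by
  obtain ⟨Y, h1, h2, h3⟩ := exists_tendsto_isLocalMax (f := fun k y => -f k y) (g := fun y => -g y)
    (φ := fun y => -φ y) (x := x) (l := l) (fun k y c hc => by
      filter_upwards [hf k y (-c) (by linarith)] with z hz using by linarith) hfg.neg hφ.neg
    (fun c hc U hU => by
      filter_upwards [hrec (-c) (by linarith) U hU] with k ⟨y, hy, hlt⟩
      exact ⟨y, hy, by linarith⟩)
    (by filter_upwards [hx] with y hy using by linarith)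
  refine ⟨Y, h1, by simpa using h2.neg, ?_⟩
  filter_upwards [h3] with k hk
  filter_upwards [hk] with y hy
  linarith

/-- Along a sequence of points, the jet of a `C²` function is eventually close to its limit. -/
lemma eventually_jet_close {ι : Type*} {l : Filter ι} {ψ : E d → ℝ} (hψ : ContDiff ℝ 2 ψ)
    {Y : ι → E d} {x : E d} (hY : Tendsto Y l (𝓝 x)) {e : ℝ} (he : 0 < e) :
    ∀ᶠ k in l, ‖Y k - x‖ ≤ e ∧ ‖gradient ψ (Y k) - gradient ψ x‖ ≤ e ∧
      ∀ i j, |hess ψ (Y k) i j - hess ψ x i j| ≤ e := by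
  have key {G : Type _} [NormedAddCommGroup G] {h : E d → G} (hh : Continuous h) :
      ∀ᶠ k in l, ‖h (Y k) - h x‖ ≤ e := by
    have := ((hh.tendsto x).comp hY).eventually (Metric.closedBall_mem_nhds _ he)
    simpa only [Metric.mem_closedBall, dist_eq_norm, Function.comp] using this
  exact (key continuous_id).and ((key (continuous_gradient hψ)).and
    (eventually_all.2 fun i => eventually_all.2 fun j => key (continuous_hess hψ i j)))

lemma H1.Ham_limit_le (h1 : H1 P C lam0) {ι : Type*} {l : Filter ι} {f : ι → Fin M → E d → ℝ}
    {g : Fin M → E d → ℝ} {B : ℝ} (hfB : ∀ k j x, |f k j x| ≤ B) (hgB : ∀ j x, |g j x| ≤ B)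
    (hfg : ∀ j, RelUpper l (fun k => f k j) (g j)) {ψ : E d → ℝ} (hψ : ContDiff ℝ 2 ψ)
    {Y : ι → E d} {x : E d} (hY : Tendsto Y l (𝓝 x)) {i : Fin M}
    (hi : Tendsto (fun k => f k i (Y k)) l (𝓝 (g i x))) {ε : ℝ} (hε : 0 < ε) :
    ∀ᶠ k in l, P.Ham i x (fun j => g j x) (gradient ψ x) (hess ψ x)
      ≤ P.Ham i (Y k) (fun j => f k j (Y k)) (gradient ψ (Y k)) (hess ψ (Y k)) + ε := by
  obtain ⟨K, hK⟩ := h1.exists_Ham_le i B (gradient ψ x) (hess ψ x)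
  have he : 0 < ε / (|K| + 1) := by positivity
  have hKe : K * (ε / (|K| + 1)) ≤ ε := by
    rw [mul_div_assoc', div_le_iff₀ (by positivity)]
    nlinarith [le_abs_self K]
  filter_upwards [eventually_jet_close hψ hY he, hi.eventually (lt_mem_nhds (sub_lt_self _ he)),
    eventually_all.2 fun j => (hfg j).eventually hY (lt_add_of_pos_right (g j x) he)]
    with k ⟨a1, a2, a3⟩ a4 a5
  have := (hK _ (Y k) x (gradient ψ (Y k)) (hess ψ (Y k)) (fun j => f k j (Y k))
    (fun j => g j x) a1 a2 a3 (fun j => hfB k j _) (fun j => hgB j x)).2 (by linarith)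
    (fun j _ => (a5 j).le)
  linarith

lemma H1.Ham_le_limit (h1 : H1 P C lam0) {ι : Type*} {l : Filter ι} {f : ι → Fin M → E d → ℝ}
    {g : Fin M → E d → ℝ} {B : ℝ} (hfB : ∀ k j x, |f k j x| ≤ B) (hgB : ∀ j x, |g j x| ≤ B)
    (hfg : ∀ j, RelLower l (fun k => f k j) (g j)) {ψ : E d → ℝ} (hψ : ContDiff ℝ 2 ψ)
    {Y : ι → E d} {x : E d} (hY : Tendsto Y l (𝓝 x)) {i : Fin M}
    (hi : Tendsto (fun k => f k i (Y k)) l (𝓝 (g i x))) {ε : ℝ} (hε : 0 < ε) :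
    ∀ᶠ k in l, P.Ham i (Y k) (fun j => f k j (Y k)) (gradient ψ (Y k)) (hess ψ (Y k))
      ≤ P.Ham i x (fun j => g j x) (gradient ψ x) (hess ψ x) + ε := by
  obtain ⟨K, hK⟩ := h1.exists_Ham_le i B (gradient ψ x) (hess ψ x)
  have he : 0 < ε / (|K| + 1) := by positivity
  have hKe : K * (ε / (|K| + 1)) ≤ ε := by
    rw [mul_div_assoc', div_le_iff₀ (by positivity)]
    nlinarith [le_abs_self K]
  filter_upwards [eventually_jet_close hψ hY he, hi.eventually (gt_mem_nhds
    (lt_add_of_pos_right _ he)), eventually_all.2 fun j => (hfg j).eventually hY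
    (sub_lt_self (g j x) he)] with k ⟨a1, a2, a3⟩ a4 a5
  have := (hK _ (Y k) x (gradient ψ (Y k)) (hess ψ (Y k)) (fun j => f k j (Y k))
    (fun j => g j x) a1 a2 a3 (fun j => hfB k j _) (fun j => hgB j x)).1 a4.le
    (fun j _ => by linarith [a5 j])
  linarith

end Stability

section Penalty

variable {P : HJBData d d' M 𝒜} {Q : ImpulseData d M 𝒵} {C lam0 κ₀ : ℝ}

/-- Existence and properties of the lower semicontinuous envelope of a bounded function. -/
lemma exists_lowerSemicontinuous_envelope {u : E d → ℝ} {B : ℝ} (hB : ∀ x, |u x| ≤ B) :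
    ∃ v : E d → ℝ, LowerSemicontinuous v ∧ (∀ x, |v x| ≤ B) ∧ (∀ x, v x ≤ u x) ∧
      (∀ y c, c < v y → ∀ᶠ z in 𝓝 y, c < u z) ∧
      ∀ x c, v x < c → ∃ᶠ z in 𝓝 x, u z < c := by
  have hb : ∀ x : E d, IsBoundedUnder (· ≥ ·) (𝓝 x) u := fun x =>
    isBoundedUnder_of ⟨-B, fun y => (abs_le.1 (hB y)).1⟩
  have hcb : ∀ x : E d, IsCoboundedUnder (· ≥ ·) (𝓝 x) u := fun x =>
    (isBoundedUnder_of (r := (· ≤ ·)) ⟨B, fun y => (abs_le.1 (hB y)).2⟩).isCoboundedUnder_ge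
  have hle : ∀ x, liminf u (𝓝 x) ≤ u x := fun x =>
    liminf_le_of_frequently_le (frequently_iff.2 fun hU => ⟨x, mem_of_mem_nhds hU, le_rfl⟩) (hb x)
  refine ⟨fun x => liminf u (𝓝 x), fun x c hc => ?_, fun x => abs_le.2 ⟨?_, ?_⟩, hle,
    fun y c hc => eventually_lt_of_lt_liminf hc (hb y),
    fun x c hc => frequently_lt_of_liminf_lt (hcb x) hc⟩
  · obtain ⟨c', h1, h2⟩ := exists_between hc
    filter_upwards [(eventually_lt_of_lt_liminf h2 (hb x)).eventually_nhds] with y hy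
    exact h1.trans_le (le_liminf_of_le (hcb y) (hy.mono fun _ h => h.le))
  · exact le_liminf_of_le (hcb x) (Eventually.of_forall fun y => (abs_le.1 (hB y)).1)
  · exact (hle x).trans (abs_le.1 (hB x)).2

lemma isLocalMin_quadTest_zero {x p : E d} {X : E d →L[ℝ] E d}
    (h : IsLocalMin (quadTest x p X) x) : p = 0 ∧ ∀ v, 0 ≤ ⟪X v, v⟫ := by
  have hp : p = 0 := by
    rw [← gradient_quadTest x p X, gradient, h.fderiv_eq_zero, map_zero]
  refine ⟨hp, fun v => ?_⟩
  have hl : Tendsto (fun t : ℝ => x + t • v) (𝓝[>] 0) (𝓝 x) := by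
    have : Continuous fun t : ℝ => x + t • v := by fun_prop
    simpa using (this.tendsto 0).mono_left nhdsWithin_le_nhds
  obtain ⟨t, ht, ht0⟩ := ((hl.eventually h).and self_mem_nhdsWithin).exists
  have ht0 : 0 < t := ht0
  simp only [hp, quadTest, sub_self, map_zero, inner_zero_left, add_sub_cancel_left, map_smul,
    real_inner_smul_left, real_inner_smul_right, mul_zero, add_zero, zero_add] at ht
  by_contra! hneg
  nlinarith [mul_pos ht0 ht0]

/-- A sufficiently negative constant is a subsolution of the penalized system. -/
lemma quadSub_const (h1 : H1 P C lam0) (h2 : H2 Q κ₀) {B : ℝ} (hB : C ≤ B * lam0) (hB0 : 0 ≤ B)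
    (ρ : ℝ) : QuadSub (Fpen P Q ρ) fun _ _ => -B := fun i x p X hx => by
  have hmin : IsLocalMin (quadTest x p X) x := by
    filter_upwards [hx] with y hy using by linarith
  obtain ⟨rfl, hX⟩ := isLocalMin_quadTest_zero hmin
  have hM : -B + κ₀ ≤ Q.Mop i (fun _ _ => -B) x :=
    h2.le_Mop fun z hz => by linarith [h2.2.2.2.2.2 i x z hz]
  have hH : P.Ham i x (fun _ => -B) 0 (hess (quadTest x 0 X) x) ≤ 0 := by
    refine h1.Ham_le fun α hα => ?_
    obtain ⟨-, -, -, -, -, -, -, -, -, -, -, hl, -, -, -, hlam⟩ := h1.2.2 i α hα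
    have a1 : 0 ≤ ∑ l, ⟪X (colVec (P.σm i α x) l), colVec (P.σm i α x) l⟫ :=
      Finset.sum_nonneg fun l _ => hX _
    have a2 : P.zpart i α x (fun _ => -B) = P.zpart i α x (fun _ => 0)
        - B * (P.cz i α x - ∑ j ∈ Finset.univ.erase i, P.dcp i j α x) := by
      rw [← zpart_sub_const]; simp
    have a3 : P.zpart i α x (fun _ => 0) = -P.runCost i α x := by simp [HJBData.zpart]
    have a4 := mul_le_mul_of_nonneg_left (hlam x) hB0
    have a5 := (abs_le.1 (hl x)).1
    rw [HJBData.L_eq, a2, a3, HJBData.dpart, trace_hess_quadTest, inner_zero_right]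
    linarith
  have hm : max (-B - Q.Mop i (fun _ _ => -B) x) 0 = 0 := max_eq_right (by linarith [h2.1])
  simp only [Fpen, hm, mul_zero, add_zero]
  exact hH

lemma QuadSub.of_penalty_le {ρ₁ ρ₂ : ℝ} (hρ : ρ₁ ≤ ρ₂) {u : Fin M → E d → ℝ}
    (h : QuadSub (Fpen P Q ρ₂) u) : QuadSub (Fpen P Q ρ₁) u := fun i x p X hx =>
  (add_le_add_right (mul_le_mul_of_nonneg_right hρ (le_max_right _ _)) _).trans (h i x p X hx)

/-- The pointwise limit of penalized solutions is a subsolution of the HJBQVI. -/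
lemma isSubsolution_of_penalty (h1 : H1 P C lam0) (h2 : H2 Q κ₀) {U : ℝ → Fin M → E d → ℝ}
    {u : Fin M → E d → ℝ} {B : ℝ} (hUB : ∀ ρ j x, |U ρ j x| ≤ B) (huB : ∀ j x, |u j x| ≤ B)
    (hU : ∀ᶠ ρ in atTop, IsSubsolution (Fpen P Q ρ) (U ρ))
    (hUc : ∀ ρ j, UpperSemicontinuous (U ρ j)) (hu : ∀ j, UpperSemicontinuous (u j))
    (hrel : ∀ j, RelUpper atTop (fun ρ => U ρ j) (u j))
    (hlim : ∀ j x, Tendsto (fun ρ => U ρ j x) atTop (𝓝 (u j x))) :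
    IsSubsolution (Fqvi P Q) u := by
  refine ⟨hu, fun i φ hφ x hx => ?_⟩
  obtain ⟨ψ, hψ, hg, hh, hψe⟩ := exists_quartic_perturbation hφ x 1
  obtain ⟨Y, hY, hUY, hmax⟩ := exists_tendsto_isLocalMax (fun ρ => hUc ρ i) (hrel i)
    hφ.continuous (fun c hc V hV => by
      filter_upwards [(hlim i x).eventually (lt_mem_nhds hc)] with ρ hρ
      exact ⟨x, mem_of_mem_nhds hV, hρ⟩) hx
  have hmax' : ∀ᶠ ρ in atTop, IsLocalMax (fun y => U ρ i y - ψ y) (Y ρ) := by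
    simpa only [hψe, one_mul] using hmax
  have hHam {ε : ℝ} (hε : 0 < ε) := h1.Ham_limit_le hUB huB hrel hψ hY hUY hε
  rw [← hg, ← hh]
  have hsub : ∀ᶠ ρ in atTop, 0 ≤ ρ ∧ P.Ham i (Y ρ) (fun j => U ρ j (Y ρ)) (gradient ψ (Y ρ))
      (hess ψ (Y ρ)) + ρ * max (U ρ i (Y ρ) - Q.Mop i (U ρ) (Y ρ)) 0 ≤ 0 := by
    filter_upwards [hmax', eventually_ge_atTop 0, hU] with ρ k1 k2 k3
    exact ⟨k2, k3.2 i ψ hψ _ k1⟩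
  refine max_le (le_of_forall_pos_le_add fun ε hε => ?_) ?_
  · obtain ⟨ρ, k1, k2, k3⟩ := ((hHam hε).and hsub).exists
    linarith [mul_nonneg k2 (le_max_right (U ρ i (Y ρ) - Q.Mop i (U ρ) (Y ρ)) 0)]
  · by_contra! hpos
    set η := (u i x - Q.Mop i u x) / 3 with hη
    have hη0 : 0 < η := by rw [hη]; linarith
    obtain ⟨ρ, k1, ⟨k2, k3⟩, k4, k5, k6⟩ := ((hHam one_pos).and (hsub.and
      ((hUY.eventually (lt_mem_nhds (sub_lt_self _ hη0))).and ((h2.Mop_upper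
        (fun ρ y => (abs_le.1 (hUB ρ i y)).1) (hrel i) hY (lt_add_of_pos_right _ hη0)).and
        (eventually_ge_atTop ((2 - P.Ham i x (fun j => u j x) (gradient ψ x) (hess ψ x))
          / η)))))).exists
    rw [div_le_iff₀ hη0] at k6
    have k7 := mul_le_mul_of_nonneg_left ((show η ≤ U ρ i (Y ρ) - Q.Mop i (U ρ) (Y ρ) by
      linarith).trans (le_max_left _ 0)) k2
    linarith

/-- A recoverable lower limit of penalized solutions is a supersolution of the HJBQVI. -/
lemma isSupersolution_of_penalty (h1 : H1 P C lam0) (h2 : H2 Q κ₀) {U : ℝ → Fin M → E d → ℝ}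
    {v : Fin M → E d → ℝ} {B : ℝ} (hUB : ∀ ρ j x, |U ρ j x| ≤ B) (hvB : ∀ j x, |v j x| ≤ B)
    (hU : ∀ᶠ ρ in atTop, IsSupersolution (Fpen P Q ρ) (U ρ))
    (hUc : ∀ ρ j, LowerSemicontinuous (U ρ j)) (hv : ∀ j, LowerSemicontinuous (v j))
    (hrel : ∀ j, RelLower atTop (fun ρ => U ρ j) (v j))
    (hrec : ∀ j x c, v j x < c → ∀ V ∈ 𝓝 x, ∀ᶠ ρ in atTop, ∃ y ∈ V, U ρ j y < c) :
    IsSupersolution (Fqvi P Q) v := by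
  refine ⟨hv, fun i φ hφ x hx => ?_⟩
  obtain ⟨ψ, hψ, hg, hh, hψe⟩ := exists_quartic_perturbation hφ x (-1)
  obtain ⟨Y, hY, hUY, hmin⟩ := exists_tendsto_isLocalMin (fun ρ => hUc ρ i) (hrel i)
    hφ.continuous (hrec i x) hx
  have hmin' : ∀ᶠ ρ in atTop, IsLocalMin (fun y => U ρ i y - ψ y) (Y ρ) := by
    simpa only [hψe, neg_one_mul, ← sub_eq_add_neg] using hmin
  rw [← hg, ← hh]
  rcases le_or_gt (Q.Mop i v x) (v i x) with hobs | hobs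
  · exact le_max_of_le_right (sub_nonneg.2 hobs)
  · refine le_max_of_le_left (le_of_forall_pos_le_add fun ε hε => ?_)
    obtain ⟨c, hc1, hc2⟩ := exists_between hobs
    obtain ⟨ρ, k1, k2, k3, k4, k5⟩ := ((h1.Ham_le_limit hUB hvB hrel hψ hY hUY hε).and
      (hmin'.and (hU.and ((hUY.eventually (gt_mem_nhds hc1)).and
      (h2.Mop_lower (fun y => (abs_le.1 (hvB i y)).1) (hrel i) hY hc2))))).exists
    have k6 := k3.2 i ψ hψ _ k2
    have hm : max (U ρ i (Y ρ) - Q.Mop i (U ρ) (Y ρ)) 0 = 0 := max_eq_right (by linarith)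
    simp only [Fpen, hm, mul_zero, add_zero] at k6
    linarith

lemma comparison_of_bdd (h1 : H1 P C lam0) (h2 : H2 Q κ₀) {Φ : ℝ → ℝ → ℝ}
    (hΦ : IsCombiner Φ) {u v : Fin M → E d → ℝ} (huB : Bdd u) (hvB : Bdd v)
    (hu : ∀ j, UpperSemicontinuous (u j)) (hv : ∀ j, LowerSemicontinuous (v j))
    (hsub : QuadSub (combOp P Q Φ) u) (hsup : QuadSuper (combOp P Q Φ) v) (i : Fin M) (x : E d) :
    u i x ≤ v i x := by
  obtain ⟨B₁, hB₁⟩ := huB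
  obtain ⟨B₂, hB₂⟩ := hvB
  exact comparison h1 h2 hΦ hu hv (fun j y => (hB₁ j y).trans (le_max_left B₁ B₂))
    (fun j y => (hB₂ j y).trans (le_max_right B₁ B₂)) hsub hsup i x

end Penalty

/-- Monotone convergence of the penalty approximation: under (H.1)
and (H.2), the HJBQVI has a unique bounded viscosity solution `u`; the penalized
solutions `u^ρ` decrease monotonically in `ρ`, dominate `u`, and converge to `u`
uniformly on compact sets as `ρ → ∞`. -/
theorem monotone_convergence_penalty
    {d d' M : ℕ} {𝒜 𝒵 : Type} [MetricSpace 𝒜] [MetricSpace 𝒵]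
    (P : HJBData d d' M 𝒜) (Q : ImpulseData d M 𝒵) (C lam0 κ₀ : ℝ)
    (h1 : H1 P C lam0) (h2 : H2 Q κ₀)
    (uρ : ℝ → Fin M → E d → ℝ)
    (huρ : ∀ ρ : ℝ, 0 ≤ ρ → Bdd (uρ ρ) ∧ IsSolution (Fpen P Q ρ) (uρ ρ)) :
    ∃ u : Fin M → E d → ℝ, Bdd u ∧ IsSolution (Fqvi P Q) u ∧
      (∀ u' : Fin M → E d → ℝ, Bdd u' → IsSolution (Fqvi P Q) u' → u' = u) ∧
      (∀ ρ₁ ρ₂ : ℝ, 0 ≤ ρ₁ → ρ₁ ≤ ρ₂ → ∀ i x,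
        u i x ≤ uρ ρ₂ i x ∧ uρ ρ₂ i x ≤ uρ ρ₁ i x) ∧
      ∀ Kset : Set (E d), IsCompact Kset → ∀ i,
        TendstoUniformlyOn (fun ρ x => uρ ρ i x) (u i) Filter.atTop Kset := by
  have hanti : ∀ ρ₁ ρ₂, 0 ≤ ρ₁ → ρ₁ ≤ ρ₂ → ∀ i x, uρ ρ₂ i x ≤ uρ ρ₁ i x := fun ρ₁ ρ₂ h0 hle =>
    comparison_of_bdd h1 h2 (isCombiner_penalty h0) (huρ ρ₂ (h0.trans hle)).1 (huρ ρ₁ h0).1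
      (huρ ρ₂ (h0.trans hle)).2.2.1.1 (huρ ρ₁ h0).2.2.2.1
      ((huρ ρ₂ (h0.trans hle)).2.2.1.quadSub.of_penalty_le hle) (huρ ρ₁ h0).2.2.2.quadSuper
  set B₁ := |C| / lam0 with hB₁def
  have hB₁ : 0 ≤ B₁ := div_nonneg (abs_nonneg C) h1.1.le
  have hlow : ∀ ρ, 0 ≤ ρ → ∀ i x, -B₁ ≤ uρ ρ i x := fun ρ h0 =>
    comparison_of_bdd h1 h2 (isCombiner_penalty h0) (u := fun _ _ => -B₁)
      ⟨B₁, fun _ _ => by rw [abs_neg, abs_of_nonneg hB₁]⟩ (huρ ρ h0).1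
      (fun _ => upperSemicontinuous_const) (huρ ρ h0).2.2.2.1
      (quadSub_const h1 h2 (by rw [hB₁def, div_mul_cancel₀ _ h1.1.ne']; exact le_abs_self C) hB₁ ρ)
      (huρ ρ h0).2.2.2.quadSuper
  obtain ⟨B₂, hB₂⟩ := (huρ 0 le_rfl).1
  set B := max B₁ B₂
  set U : ℝ → Fin M → E d → ℝ := fun ρ => uρ (max ρ 0) with hUdef
  have hU0 : ∀ ρ : ℝ, 0 ≤ max ρ 0 := fun ρ => le_max_right _ _
  have hUeq : ∀ ρ, 0 ≤ ρ → U ρ = uρ ρ := fun ρ h0 => by simp only [hUdef, max_eq_left h0]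
  have hUc : ∀ ρ i, Continuous (U ρ i) := fun ρ i => (huρ _ (hU0 ρ)).2.1 i
  have hUanti : ∀ i x, Antitone fun ρ => U ρ i x := fun i x ρ₁ ρ₂ hle =>
    hanti _ _ (hU0 ρ₁) (max_le_max_right 0 hle) i x
  have hUlow : ∀ ρ i x, -B ≤ U ρ i x := fun ρ i x =>
    (neg_le_neg (le_max_left B₁ B₂)).trans (hlow _ (hU0 ρ) i x)
  have hUB : ∀ ρ i x, |U ρ i x| ≤ B := fun ρ i x => abs_le.2 ⟨hUlow ρ i x,
    (hanti 0 _ le_rfl (hU0 ρ) i x).trans ((abs_le.1 (hB₂ i x)).2.trans (le_max_right B₁ B₂))⟩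
  set u : Fin M → E d → ℝ := fun i x => ⨅ ρ, U ρ i x with hudef
  have hbdd : ∀ i x, BddBelow (Set.range fun ρ => U ρ i x) := fun i x =>
    ⟨-B, by rintro _ ⟨ρ, rfl⟩; exact hUlow ρ i x⟩
  have huU : ∀ ρ i x, u i x ≤ U ρ i x := fun ρ i x => ciInf_le (hbdd i x) ρ
  have huB : ∀ i x, |u i x| ≤ B := fun i x => abs_le.2 ⟨le_ciInf fun ρ => hUlow ρ i x,
    (huU 0 i x).trans (abs_le.1 (hUB 0 i x)).2⟩
  have hlim : ∀ i x, Tendsto (fun ρ => U ρ i x) atTop (𝓝 (u i x)) := fun i x =>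
    tendsto_atTop_ciInf (hUanti i x) (hbdd i x)
  have hrelU : ∀ i, RelUpper atTop (fun ρ => U ρ i) (u i) := fun i y c hc => by
    obtain ⟨ρ₀, hρ₀⟩ := exists_lt_of_ciInf_lt hc
    filter_upwards [(eventually_ge_atTop ρ₀).prod_mk
      (((hUc ρ₀ i).tendsto y).eventually (gt_mem_nhds hρ₀))] with q hq
    exact (hUanti i q.2 hq.1).trans_lt hq.2
  have husc : ∀ i, UpperSemicontinuous (u i) := fun i y c hc => by
    obtain ⟨ρ₀, hρ₀⟩ := exists_lt_of_ciInf_lt hc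
    filter_upwards [((hUc ρ₀ i).tendsto y).eventually (gt_mem_nhds hρ₀)] with z hz
    exact (huU ρ₀ i z).trans_lt hz
  choose v hvsc hvB hvu hv1 hv2 using fun i => exists_lowerSemicontinuous_envelope (huB i)
  have hsol : ∀ᶠ ρ in atTop, IsSolution (Fpen P Q ρ) (U ρ) := by
    filter_upwards [eventually_ge_atTop 0] with ρ h0
    rw [hUeq ρ h0]
    exact (huρ ρ h0).2
  have hsub : IsSubsolution (Fqvi P Q) u := isSubsolution_of_penalty h1 h2 hUB huB
    (hsol.mono fun _ h => h.2.1) (fun ρ j => (hUc ρ j).upperSemicontinuous) husc hrelU hlim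
  have hsup : IsSupersolution (Fqvi P Q) v := by
    refine isSupersolution_of_penalty h1 h2 hUB hvB (hsol.mono fun _ h => h.2.2)
      (fun ρ j => (hUc ρ j).lowerSemicontinuous) hvsc (fun j y c hc => ?_) fun j x c hc V hV => ?_
    · filter_upwards [(hv1 j y c hc).prod_inr atTop] with q hq
      exact hq.trans_le (huU q.1 j q.2)
    · obtain ⟨y, hy, hyV⟩ := ((hv2 j x c hc).and_eventually hV).exists
      filter_upwards [(hlim j y).eventually (gt_mem_nhds hy)] with ρ hρ
      exact ⟨y, hyV, hρ⟩
  have huv : u = v := funext fun i => funext fun x => le_antisymm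
    (comparison h1 h2 isCombiner_max husc hvsc huB hvB hsub.quadSub hsup.quadSuper i x) (hvu i x)
  rw [← huv] at hsup
  have hcont : ∀ i, Continuous (u i) := fun i =>
    continuous_iff_lower_upperSemicontinuous.2 ⟨hsup.1 i, husc i⟩
  refine ⟨u, ⟨B, huB⟩, ⟨hcont, hsub, hsup⟩, fun u' hu'B hu' => ?_, fun ρ₁ ρ₂ h0 hle i x => ?_,
    fun Kset hK i => ?_⟩
  · refine funext fun i => funext fun x => le_antisymm ?_ ?_
    · exact comparison_of_bdd h1 h2 isCombiner_max hu'B ⟨B, huB⟩ hu'.2.1.1 hsup.1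
        hu'.2.1.quadSub hsup.quadSuper i x
    · exact comparison_of_bdd h1 h2 isCombiner_max ⟨B, huB⟩ hu'B husc hu'.2.2.1
        hsub.quadSub hu'.2.2.quadSuper i x
  · refine ⟨?_, hanti ρ₁ ρ₂ h0 hle i x⟩
    rw [← hUeq ρ₂ (h0.trans hle)]
    exact huU ρ₂ i x
  · refine (Antitone.tendstoUniformlyOn_of_forall_tendsto hK (fun ρ => (hUc ρ i).continuousOn)
      (fun x _ => hUanti i x) (hcont i).continuousOn fun x _ => hlim i x).congr ?_
    filter_upwards [eventually_ge_atTop 0] with ρ h0 x _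
    simp only [hUeq ρ h0]

end HJBQVI
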